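/- arXiv:1112.2131 — 4 statements merged into one kernel-verified Lean document; each statement's English description precedes it below -/
import Mathlib

section
/- Let k be any field and let X := V(h₁⋯h_d) ⊂ ℙⁿ_k be a hypersurface of degree d ≤ n, where h₁,…,h_d ∈ k[x₀,…,xₙ] are homogeneous polynomials of degree 1 (so X is a union of d hyperplanes). Then [X] ≡ 1 mod 𝕃 in K₀(Var_k). -/
open AlgebraicGeometry CategoryTheory CategoryTheory.Limits MvPolynomial

universe u v

noncomputable section

attribute [local instance] MvPolynomial.gradedAlgebra

/-- The base scheme `Spec k`. -/
abbrev SpecBase (k : Type u) [Field k] : Scheme.{u} := Spec (CommRingCat.of k)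

/-- The affine line `𝔸¹_k` as a scheme over `k`. -/
def AffineLine (k : Type u) [Field k] : Scheme.{u} := Spec (CommRingCat.of (Polynomial k))

/-- The structure morphism of `𝔸¹_k`. -/
def AffineLine.toSpec (k : Type u) [Field k] : AffineLine k ⟶ SpecBase k :=
  Spec.map (CommRingCat.ofHom (algebraMap k (Polynomial k)))

/-- Projective `n`-space `ℙⁿ_k = Proj k[x₀, …, xₙ]` over `k`. -/
def ProjSpace (k : Type u) [Field k] (n : ℕ) : Scheme.{u} :=
  Proj (homogeneousSubmodule (Fin (n + 1)) k)

/-- The structure morphism of `ℙⁿ_k`. -/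
def ProjSpace.toSpec (k : Type u) [Field k] (n : ℕ) : ProjSpace k n ⟶ SpecBase k :=
  Proj.toSpecZero _ ≫ Spec.map (CommRingCat.ofHom (algebraMap k _))

/-- `X` (a scheme over `k` via `sX : X ⟶ Spec k`) is the reduced closed subvariety of `ℙⁿ_k`
cut out by the family `S` of polynomials, i.e. `X → ℙⁿ_k` is a closed immersion of the reduced
scheme `X` onto the zero locus of `S`, compatibly with the structure morphisms. -/
def IsProjSubvariety (k : Type u) [Field k] (n : ℕ) (S : Set (MvPolynomial (Fin (n + 1)) k))
    (X : Scheme.{u}) (sX : X ⟶ SpecBase k) : Prop :=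
  IsReduced X ∧ ∃ i : X ⟶ ProjSpace k n, IsClosedImmersion i ∧ i ≫ ProjSpace.toSpec k n = sX ∧
    Set.range i.base = ProjectiveSpectrum.zeroLocus (homogeneousSubmodule (Fin (n + 1)) k) S

/-- `X` has a `k`-rational point, i.e. the structure morphism has a section. -/
def HasRatPoint (k : Type u) [Field k] (X : Scheme.{u}) (sX : X ⟶ SpecBase k) : Prop :=
  ∃ p : SpecBase k ⟶ X, p ≫ sX = 𝟙 (SpecBase k)

/-- A motivic measure on varieties over `k` with values in a commutative ring `R`: an
assignment, to every scheme over `k`, of an element of `R` which, on separated schemes of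
finite type over `k` (i.e. on the category `Var_k`, reducedness being irrelevant), is
invariant under isomorphisms over `k`, satisfies the scissor relations
`[X] = [X ∖ Z] + [Z]` for closed subschemes `Z ⊆ X`, is multiplicative on fibre products
over `k`, and sends `Spec k` to `1`.  These are exactly the defining relations of the
Grothendieck ring of varieties `K₀(Var_k)`, so an identity holds in `K₀(Var_k)` if and
only if it holds for every motivic measure. -/
structure MotivicMeasure (k : Type u) [Field k] (R : Type v) [CommRing R] where
  cl : ∀ (X : Scheme.{u}), (X ⟶ SpecBase k) → R
  cl_point : cl (SpecBase k) (𝟙 (SpecBase k)) = 1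
  cl_iso : ∀ {X Y : Scheme.{u}} (sX : X ⟶ SpecBase k) (sY : Y ⟶ SpecBase k) (e : X ≅ Y),
    LocallyOfFiniteType sX → QuasiCompact sX → IsSeparated sX →
    e.hom ≫ sY = sX → cl X sX = cl Y sY
  cl_scissor : ∀ {X Z : Scheme.{u}} (sX : X ⟶ SpecBase k) (i : Z ⟶ X),
    LocallyOfFiniteType sX → QuasiCompact sX → IsSeparated sX →
    IsClosedImmersion i → ∀ U : X.Opens, (U : Set X) = (Set.range i.base)ᶜ →
    cl X sX = cl U.toScheme (U.ι ≫ sX) + cl Z (i ≫ sX)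
  cl_prod : ∀ {X Y : Scheme.{u}} (sX : X ⟶ SpecBase k) (sY : Y ⟶ SpecBase k),
    LocallyOfFiniteType sX → QuasiCompact sX → IsSeparated sX →
    LocallyOfFiniteType sY → QuasiCompact sY → IsSeparated sY →
    cl (pullback sX sY) (pullback.fst sX sY ≫ sX) = cl X sX * cl Y sY

/-- The class of the affine line, `𝕃 = [𝔸¹_k]`, under a motivic measure. -/
def MotivicMeasure.lef {k : Type u} [Field k] {R : Type v} [CommRing R]
    (μ : MotivicMeasure k R) : R :=
  μ.cl (AffineLine k) (AffineLine.toSpec k)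

/-- `X` and `Y` are birational over `k`: they contain isomorphic dense open subschemes. -/
def BirationalOver (k : Type u) [Field k] (X Y : Scheme.{u})
    (sX : X ⟶ SpecBase k) (sY : Y ⟶ SpecBase k) : Prop :=
  ∃ (U : X.Opens) (V : Y.Opens) (e : U.toScheme ≅ V.toScheme),
    Dense (U : Set X) ∧ Dense (V : Set Y) ∧ e.hom ≫ V.ι ≫ sY = U.ι ≫ sX

end

namespace MotivicMeasure

variable {k : Type u} [Field k] {R : Type v} [CommRing R] (μ : MotivicMeasure k R)

/-- Over a field, the restriction of a morphism of finite type along an open immersion is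
quasi-compact. -/
lemma quasiCompact_openImmersion_comp {V Y : Scheme.{u}} (s : Y ⟶ SpecBase k)
    [LocallyOfFiniteType s] [QuasiCompact s] (j : V ⟶ Y) [IsOpenImmersion j] :
    QuasiCompact (j ≫ s) := by
  have : IsLocallyNoetherian Y := LocallyOfFiniteType.isLocallyNoetherian s
  infer_instance

/-- The class of an open subscheme of `Y`. -/
noncomputable abbrev clOpen {Y : Scheme.{u}} (s : Y ⟶ SpecBase k) (U : Y.Opens) : R :=
  μ.cl U.toScheme (U.ι ≫ s)

lemma clOpen_opensRange {V Y : Scheme.{u}} (s : Y ⟶ SpecBase k)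
    [LocallyOfFiniteType s] [QuasiCompact s] [IsSeparated s] (j : V ⟶ Y) [IsOpenImmersion j] :
    μ.clOpen s j.opensRange = μ.cl V (j ≫ s) := by
  have := quasiCompact_openImmersion_comp s j
  refine (μ.cl_iso (j ≫ s) _ (IsOpenImmersion.isoOfRangeEq j j.opensRange.ι (by simp))
    inferInstance inferInstance inferInstance ?_).symm
  rw [IsOpenImmersion.isoOfRangeEq_hom_fac_assoc]

lemma clOpen_eq_add {Y Z : Scheme.{u}} (s : Y ⟶ SpecBase k)
    [LocallyOfFiniteType s] [QuasiCompact s] [IsSeparated s]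
    (i : Z ⟶ Y) [IsClosedImmersion i] (U : Y.Opens) (hU : (U : Set Y) = (Set.range i)ᶜ)
    (V : Y.Opens) :
    μ.clOpen s V = μ.clOpen s (U ⊓ V) + μ.clOpen (i ≫ s) (i ⁻¹ᵁ V) := by
  have := quasiCompact_openImmersion_comp s V.ι
  have h := μ.cl_scissor (V.ι ≫ s) (i ∣_ V) inferInstance inferInstance inferInstance
    inferInstance (V.ι ⁻¹ᵁ U) (by
      ext x
      have hx : V.ι x ∈ (U : Set Y) ↔ V.ι x ∈ (Set.range i)ᶜ := by rw [hU]
      have hr : Set.range (i ∣_ V) = V.ι ⁻¹' Set.range i := by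
        rw [morphismRestrict_base]
        exact Set.range_restrictPreimage _ _
      change V.ι x ∈ (U : Set Y) ↔ x ∈ (Set.range (i ∣_ V))ᶜ
      rw [hx, hr]
      rfl)
  rw [clOpen, h]
  congr 1
  · have h2 := μ.clOpen_opensRange s ((V.ι ⁻¹ᵁ U).ι ≫ V.ι)
    rw [Category.assoc] at h2
    rw [← h2]
    congr 1
    ext x
    simp only [Scheme.Hom.opensRange_comp, Scheme.Opens.opensRange_ι, SetLike.mem_coe,
      TopologicalSpace.Opens.mem_inf]
    refine ⟨?_, fun ⟨hx, hV⟩ ↦ ⟨⟨x, hV⟩, hx, rfl⟩⟩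
    rintro ⟨y, hy, rfl⟩
    exact ⟨hy, y.2⟩
  · rw [morphismRestrict_ι_assoc]

lemma clOpen_bot {Y : Scheme.{u}} (s : Y ⟶ SpecBase k)
    [LocallyOfFiniteType s] [QuasiCompact s] [IsSeparated s] :
    μ.clOpen s ⊥ = 0 := by
  have h := μ.clOpen_eq_add s (𝟙 Y) ⊥ (by simp) ⊥
  simpa using h

lemma clOpen_sup_add_inf {Y : Scheme.{u}} (s : Y ⟶ SpecBase k)
    [LocallyOfFiniteType s] [QuasiCompact s] [IsSeparated s] (U V : Y.Opens) :
    μ.clOpen s (U ⊔ V) + μ.clOpen s (U ⊓ V) = μ.clOpen s U + μ.clOpen s V := by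
  let I := Scheme.IdealSheafData.vanishingIdeal (X := Y) ⟨(U : Set Y)ᶜ, U.isOpen.isClosed_compl⟩
  let i := I.subschemeι
  have hi : (U : Set Y) = (Set.range i)ᶜ := by
    rw [Scheme.IdealSheafData.range_subschemeι, Scheme.IdealSheafData.coe_support_vanishingIdeal]
    simp
  have h : i ⁻¹ᵁ (U ⊔ V) = i ⁻¹ᵁ V := by
    ext x
    have : i x ∉ U := fun hx ↦ (hi.le hx) ⟨x, rfl⟩
    simp [this]
  have h1 := μ.clOpen_eq_add s i U hi (U ⊔ V)
  have h2 := μ.clOpen_eq_add s i U hi V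
  rw [h, inf_sup_self] at h1
  rw [h1, h2]
  ring

/-- If an ideal contains the class of every member of a family of opens stable under
intersection, then it contains the class of every finite union of members. -/
lemma clOpen_finset_sup_mem {Y : Scheme.{u}} (s : Y ⟶ SpecBase k)
    [LocallyOfFiniteType s] [QuasiCompact s] [IsSeparated s] (I : Ideal R)
    (F : Set Y.Opens) (hF : ∀ U ∈ F, ∀ V ∈ F, U ⊓ V ∈ F) (hI : ∀ U ∈ F, μ.clOpen s U ∈ I)
    {ι : Type*} (t : Finset ι) (U : ι → Y.Opens) (hU : ∀ i ∈ t, U i ∈ F) :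
    μ.clOpen s (t.sup U) ∈ I := by
  classical
  induction t using Finset.induction_on generalizing U with
  | empty => simp only [Finset.sup_empty, clOpen_bot, I.zero_mem]
  | insert a t ha ih =>
    have h := μ.clOpen_sup_add_inf s (U a) (t.sup U)
    rw [Finset.sup_insert, eq_sub_of_add_eq h]
    refine I.sub_mem (I.add_mem (hI _ (hU a (by simp))) (ih U fun i hi ↦ hU i (by simp [hi]))) ?_
    rw [Finset.sup_inf_distrib_left]
    exact ih _ fun i hi ↦ hF _ (hU a (by simp)) _ (hU i (by simp [hi]))

end MotivicMeasure

section HomogeneousPolynomials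

variable {k : Type u} [Field k] {σ : Type*}

lemma MvPolynomial.aeval_const_mul_of_isHomogeneous {S : Type*} [CommRing S] [Algebra k S]
    {φ : MvPolynomial σ k} {m : ℕ} (hφ : φ.IsHomogeneous m) (c : S) (y : σ → S) :
    aeval (fun i ↦ c * y i) φ = c ^ m * aeval y φ := by
  rw [aeval_def, aeval_def, eval₂_eq, eval₂_eq, Finset.mul_sum]
  refine Finset.sum_congr rfl fun d hd ↦ ?_
  have hdeg : ∑ i ∈ d.support, d i = m := by
    have := hφ (mem_support_iff.mp hd)
    simpa [Finsupp.weight_apply, Finsupp.sum] using this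
  simp only [mul_pow, Finset.prod_mul_distrib, Finset.prod_pow_eq_pow_sum, hdeg]
  ring

lemma MvPolynomial.aeval_add_of_isHomogeneous_one {S : Type*} [CommRing S] [Algebra k S]
    {φ : MvPolynomial σ k} (hφ : φ.IsHomogeneous 1) (y z : σ → S) :
    aeval (fun i ↦ y i + z i) φ = aeval y φ + aeval z φ := by
  have h : φ ∈ Submodule.span k (Set.range (X : σ → MvPolynomial σ k)) := by
    rw [← homogeneousSubmodule_one_eq_span_X]
    exact hφ
  clear hφ
  induction h using Submodule.span_induction with
  | mem x hx =>
    obtain ⟨i, rfl⟩ := hx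
    simp
  | zero => simp
  | add x y _ _ hx hy => simp only [map_add, hx, hy]; ring
  | smul a x _ hx => simp only [map_smul, hx, smul_add]

/-- A polynomial is invariant under translation by `v` if it takes the same value at `y` and
`y + t v` for all points `y` and scalars `t` with values in any `k`-algebra. -/
def MvPolynomial.IsTranslationInvariant (v : σ → k) (f : MvPolynomial σ k) : Prop :=
  ∀ (S : Type u) [CommRing S] [Algebra k S] (y : σ → S) (t : S),
    aeval (fun i ↦ y i + t * algebraMap k S (v i)) f = aeval y f

lemma MvPolynomial.IsTranslationInvariant.mul {v : σ → k} {f g : MvPolynomial σ k}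
    (hf : f.IsTranslationInvariant v) (hg : g.IsTranslationInvariant v) :
    (f * g).IsTranslationInvariant v := by
  intro S _ _ y t
  rw [map_mul, map_mul, hf, hg]

lemma MvPolynomial.IsTranslationInvariant.prod {ι : Type*} {v : σ → k}
    {f : ι → MvPolynomial σ k} (t : Finset ι) (hf : ∀ i ∈ t, (f i).IsTranslationInvariant v) :
    (∏ i ∈ t, f i).IsTranslationInvariant v := by
  intro S _ _ y s
  rw [map_prod, map_prod]
  exact Finset.prod_congr rfl fun i hi ↦ hf i hi S y s

lemma MvPolynomial.isTranslationInvariant_of_isHomogeneous_one {v : σ → k} {f : MvPolynomial σ k}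
    (hf : f.IsHomogeneous 1) (hv : eval v f = 0) : f.IsTranslationInvariant v := by
  intro S _ _ y t
  rw [aeval_add_of_isHomogeneous_one hf, aeval_const_mul_of_isHomogeneous hf]
  have : aeval (fun i ↦ algebraMap k S (v i)) f = algebraMap k S (eval v f) := by
    rw [← aeval_eq_eval, ← aeval_algebraMap_apply]
    rfl
  simp [this, hv]

end HomogeneousPolynomials

section Charts

open HomogeneousLocalization

attribute [local instance] MvPolynomial.gradedAlgebra

variable {k : Type u} [Field k] {n : ℕ}

/-- The structure morphism of the degree zero part of the localization of `k[x₀, …, xₙ]`. -/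
noncomputable def awayAlgebraMap (f : MvPolynomial (Fin (n + 1)) k) :
    k →+* Away (homogeneousSubmodule (Fin (n + 1)) k) f :=
  (fromZeroRingHom _ _).comp (algebraMap k (homogeneousSubmodule (Fin (n + 1)) k 0))

lemma val_awayAlgebraMap (f : MvPolynomial (Fin (n + 1)) k) (c : k) :
    (awayAlgebraMap f c).val =
      algebraMap (MvPolynomial (Fin (n + 1)) k) (Localization.Away f) (C c) :=
  Localization.mk_one_eq_algebraMap (M := Submonoid.powers f) (C c)

lemma val_awayMk {d : ℕ} {f : MvPolynomial (Fin (n + 1)) k}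
    (hf : f ∈ homogeneousSubmodule (Fin (n + 1)) k d) (r : ℕ) (x : MvPolynomial (Fin (n + 1)) k)
    (hx : x ∈ homogeneousSubmodule (Fin (n + 1)) k (r • d)) :
    (Away.mk (homogeneousSubmodule (Fin (n + 1)) k) hf r x hx).val =
      algebraMap _ (Localization.Away f) x * IsLocalization.Away.invSelf f ^ r := by
  rw [Away.val_mk, Localization.mk_eq_mk', IsLocalization.mk'_eq_iff_eq_mul, mul_assoc]
  simp only [map_pow]
  rw [← mul_pow, mul_comm (IsLocalization.Away.invSelf f), IsLocalization.Away.mul_invSelf,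
    one_pow, mul_one]

/-- The universal `k`-algebra carrying a point `y` on the hyperplanes `yₘ = 0` and `l = 1` at which
`f` is invertible. -/
lemma exists_slice_algebra (m : Fin (n + 1)) (l f : MvPolynomial (Fin (n + 1)) k) :
    ∃ (B : Type u) (_ : CommRing B) (_ : Algebra k B) (y : Fin (n + 1) → B) (z : B),
      Algebra.FiniteType k B ∧ y m = 0 ∧ aeval y l = 1 ∧ z * aeval y f = 1 ∧
      (∀ (S : Type u) [CommRing S] [Algebra k S] (y' : Fin (n + 1) → S) (z' : S),
        y' m = 0 → aeval y' l = 1 → z' * aeval y' f = 1 →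
        ∃ φ : B →ₐ[k] S, (∀ i, φ (y i) = y' i) ∧ φ z = z') ∧
      (∀ (S : Type u) [CommRing S] [Algebra k S] (φ φ' : B →ₐ[k] S),
        (∀ i, φ (y i) = φ' (y i)) → φ z = φ' z → φ = φ') := by
  let y₀ : Fin (n + 1) → MvPolynomial (Option (Fin (n + 1))) k := fun i ↦ X (some i)
  let J : Ideal (MvPolynomial (Option (Fin (n + 1))) k) :=
    Ideal.span {y₀ m, aeval y₀ l - 1, X none * aeval y₀ f - 1}
  let q : MvPolynomial (Option (Fin (n + 1))) k →ₐ[k] _ := Ideal.Quotient.mkₐ k J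
  have hqy : ∀ p, q (aeval y₀ p) = aeval (fun i ↦ q (X (some i))) p := fun p ↦ by
    rw [← AlgHom.comp_apply, comp_aeval]
  have hq : ∀ p ∈ ({y₀ m, aeval y₀ l - 1, X none * aeval y₀ f - 1} : Set _), q p = 0 :=
    fun p hp ↦ Ideal.Quotient.eq_zero_iff_mem.mpr (Ideal.subset_span hp)
  refine ⟨_ ⧸ J, inferInstance, inferInstance, fun i ↦ q (X (some i)), q (X none),
    inferInstance, hq (y₀ m) (Or.inl rfl), ?_, ?_, ?_, ?_⟩
  · rw [← hqy, ← sub_eq_zero, ← map_one q, ← map_sub]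
    exact hq _ (Or.inr (Or.inl rfl))
  · rw [← hqy, ← map_mul, ← sub_eq_zero, ← map_one q, ← map_sub]
    exact hq _ (Or.inr (Or.inr rfl))
  · intro S _ _ y' z' h1 h2 h3
    let w : Option (Fin (n + 1)) → S := fun o ↦ o.elim z' y'
    have hw : ∀ p, aeval w (aeval y₀ p) = aeval y' p := fun p ↦ by
      rw [← AlgHom.comp_apply, comp_aeval]
      simp [y₀, w]
    have hJ : ∀ p ∈ J, aeval w p = 0 := by
      intro p hp
      refine (Ideal.span_le (I := RingHom.ker (aeval w))).mpr ?_ hp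
      rintro p (rfl | rfl | rfl)
      · simpa [y₀, w] using h1
      · rw [SetLike.mem_coe, RingHom.mem_ker, map_sub, hw, h2, map_one, sub_self]
      · rw [SetLike.mem_coe, RingHom.mem_ker, map_sub, map_mul, hw, map_one, aeval_X]
        exact sub_eq_zero.mpr h3
    refine ⟨Ideal.Quotient.liftₐ J (aeval w) hJ, fun i ↦ ?_, ?_⟩
    · exact (Ideal.Quotient.lift_mk _ _ _).trans (aeval_X w _)
    · exact (Ideal.Quotient.lift_mk _ _ _).trans (aeval_X w _)
  · intro S _ _ φ φ' h1 h2
    refine Ideal.Quotient.algHom_ext k (MvPolynomial.algHom_ext fun o ↦ ?_)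
    cases o with
    | none => exact h2
    | some i => exact h1 i

/-- If `l` vanishes at `v` and `g` is invariant under translation by `v`, then projection from `v`
makes `D₊(l g)` a trivial line bundle. -/
lemma exists_away_equiv_polynomial (v : Fin (n + 1) → k) (m : Fin (n + 1)) (hv : v m = 1)
    {l g : MvPolynomial (Fin (n + 1)) k} {e : ℕ} (hl : l.IsHomogeneous 1) (hlv : eval v l = 0)
    (hg : g.IsHomogeneous e) (hgv : g.IsTranslationInvariant v) :
    ∃ (B : Type u) (_ : CommRing B) (_ : Algebra k B),
      Algebra.FiniteType k B ∧
      ∃ E : Polynomial B ≃+* Away (homogeneousSubmodule (Fin (n + 1)) k) (l * g),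
        ∀ c, E (Polynomial.C (algebraMap k B c)) = awayAlgebraMap (l * g) c := by
  let f := l * g
  have hf : f ∈ homogeneousSubmodule (Fin (n + 1)) k (1 + e) := hl.mul hg
  have hlT := isTranslationInvariant_of_isHomogeneous_one hl hlv
  have hfv : f.IsTranslationInvariant v := hlT.mul hgv
  let a : MvPolynomial (Fin (n + 1)) k →ₐ[k] Localization.Away f := Algebra.algHom _ _ _
  let u : Localization.Away f := IsLocalization.Away.invSelf f
  have hau : a f * u = 1 := IsLocalization.Away.mul_invSelf f
  have hlgu : a l * a g * u = 1 := by rw [← map_mul]; exact hau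
  have ha : ∀ p, aeval (fun i ↦ a (X i)) p = a p := fun p ↦ by
    exact congr($(aeval_unique a) p).symm
  obtain ⟨B, _, _, y, z, hB, hym, hyl, hyf, hlift, hext⟩ := exists_slice_algebra m l f
  have hyg : aeval y g * z = 1 := by
    rw [mul_comm, ← hyf, map_mul, hyl, one_mul]
  -- from the localization to the polynomial ring
  let α : MvPolynomial (Fin (n + 1)) k →ₐ[k] Polynomial B :=
    aeval fun i ↦ Polynomial.C (y i) + Polynomial.X * algebraMap k (Polynomial B) (v i)
  have hC : ∀ p, aeval (fun i ↦ Polynomial.C (y i)) p = Polynomial.C (aeval y p) := fun p ↦ by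
    have := comp_aeval_apply y (Polynomial.CAlgHom (R := k) (A := B)) p
    exact this.symm
  have hα : ∀ p, p.IsTranslationInvariant v → α p = Polynomial.C (aeval y p) := fun p hp ↦ by
    rw [← hC]
    exact hp _ _ _
  have hαf : α f * Polynomial.C z = 1 := by
    rw [hα f hfv, ← Polynomial.C_mul, mul_comm, hyf, Polynomial.C_1]
  let α' : Localization.Away f →+* Polynomial B :=
    IsLocalization.Away.lift f (g := (α : MvPolynomial (Fin (n + 1)) k →+* Polynomial B))
      (IsUnit.of_mul_eq_one _ hαf)
  have hα' : ∀ p, α' (a p) = α p := fun p ↦ IsLocalization.Away.lift_eq _ _ _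
  have hα'u : α' u = Polynomial.C z := by
    have h1 : α f * α' u = 1 := by rw [← hα', ← map_mul, hau, map_one]
    calc α' u = α' u * (α f * Polynomial.C z) := by rw [hαf, mul_one]
      _ = (α f * α' u) * Polynomial.C z := by ring
      _ = _ := by rw [h1, one_mul]
  let valHom : Away (homogeneousSubmodule (Fin (n + 1)) k) f →+* Localization.Away f :=
    algebraMap _ _
  have valHom_inj : Function.Injective valHom := val_injective _
  -- the elements of the degree zero part of the localization
  have hmem : ∀ p : MvPolynomial (Fin (n + 1)) k, p.IsHomogeneous 1 → p * g ∈
      homogeneousSubmodule (Fin (n + 1)) k (1 • (1 + e)) := fun p hp ↦ by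
    rw [one_smul]; exact hp.mul hg
  let ξ : ∀ p : MvPolynomial (Fin (n + 1)) k, p.IsHomogeneous 1 →
      Away (homogeneousSubmodule (Fin (n + 1)) k) f := fun p hp ↦
    Away.mk _ hf 1 (p * g) (hmem p hp)
  have hξ : ∀ p hp, valHom (ξ p hp) = a p * a g * u := fun p hp ↦ by
    refine (val_awayMk hf 1 _ (hmem p hp)).trans ?_
    rw [pow_one, ← map_mul]; rfl
  let ζ : Away (homogeneousSubmodule (Fin (n + 1)) k) f :=
    Away.mk _ hf 1 (l ^ (1 + e)) (by simpa using hl.pow (1 + e))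
  have hζ : valHom ζ = a l ^ (1 + e) * u := by
    refine (val_awayMk hf 1 _ _).trans ?_
    rw [pow_one, map_pow]; rfl
  let _ : Algebra k (Away (homogeneousSubmodule (Fin (n + 1)) k) f) := (awayAlgebraMap f).toAlgebra
  have hval : ∀ c, valHom (awayAlgebraMap f c) = algebraMap k _ c := fun c ↦
    (val_awayAlgebraMap f c).trans
      (IsScalarTower.algebraMap_apply k (MvPolynomial (Fin (n + 1)) k) (Localization.Away f) c).symm
  let valA : Away (homogeneousSubmodule (Fin (n + 1)) k) f →ₐ[k] Localization.Away f :=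
    { valHom with commutes' := hval }
  have hX : ∀ i, (X i : MvPolynomial (Fin (n + 1)) k).IsHomogeneous 1 := isHomogeneous_X k
  have hYh : ∀ i, (X i - C (v i) * X m : MvPolynomial (Fin (n + 1)) k).IsHomogeneous 1 := fun i ↦
    (hX i).sub ((hX m).C_mul _)
  let y' : Fin (n + 1) → Away (homogeneousSubmodule (Fin (n + 1)) k) f := fun i ↦ ξ _ (hYh i)
  have hy' : ∀ i, valA (y' i) =
      (a g * u) * (a (X i) + (-a (X m)) * algebraMap k (Localization.Away f) (v i)) := fun i ↦ by
    refine (hξ _ (hYh i)).trans ?_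
    have : a (C (v i)) = algebraMap k (Localization.Away f) (v i) := a.commutes (v i)
    rw [map_sub, map_mul, this]
    ring
  have hvaly : ∀ p r, p.IsHomogeneous r → p.IsTranslationInvariant v →
      valA (aeval y' p) = (a g * u) ^ r * a p := fun p r hp hpv ↦ by
    rw [← AlgHom.comp_apply, comp_aeval]
    simp only [hy']
    rw [aeval_const_mul_of_isHomogeneous hp, hpv, ha]
  obtain ⟨φ, hφy, hφz⟩ := hlift _ y' ζ
    (by
      apply valHom_inj
      refine (hy' m).trans ?_
      rw [map_zero, hv, map_one]
      ring)
    (by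
      apply valHom_inj
      refine (hvaly l 1 hl hlT).trans ?_
      rw [map_one, ← hlgu]
      ring)
    (by
      apply valHom_inj
      rw [map_mul, hζ, map_one]
      refine (congrArg _ (hvaly f (1 + e) hf hfv)).trans ?_
      calc a l ^ (1 + e) * u * ((a g * u) ^ (1 + e) * a f)
          = (a l * a g * u) ^ (1 + e) * (a f * u) := by ring
        _ = 1 := by rw [hlgu, hau, one_pow, one_mul])
  let ψ : Polynomial B →+* Away (homogeneousSubmodule (Fin (n + 1)) k) f :=
    Polynomial.eval₂RingHom φ (ξ (X m) (hX m))
  have hψC : ∀ b, ψ (Polynomial.C b) = φ b := fun b ↦ Polynomial.eval₂_C _ _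
  have hψX : ψ Polynomial.X = ξ (X m) (hX m) := Polynomial.eval₂_X _ _
  let ψA : Polynomial B →ₐ[k] Away (homogeneousSubmodule (Fin (n + 1)) k) f :=
    { ψ with commutes' := fun c ↦ (hψC _).trans (φ.commutes c) }
  have hψα : ∀ p r, p.IsHomogeneous r → valA (ψA (α p)) = (a g * u) ^ r * a p := fun p r hp ↦ by
    rw [← AlgHom.comp_apply, ← AlgHom.comp_apply, comp_aeval]
    have : ∀ i, (valA.comp ψA) (Polynomial.C (y i) +
        Polynomial.X * algebraMap k (Polynomial B) (v i)) = (a g * u) * a (X i) := fun i ↦ by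
      have h1 : valA (ψA (Polynomial.C (y i))) = valA (y' i) := by
        rw [← hφy]; exact congrArg valA (hψC _)
      have h2 : valA (ψA Polynomial.X) = a (X m) * a g * u :=
        (congrArg valA hψX).trans (hξ _ (hX m))
      rw [map_add, map_mul, AlgHom.commutes, AlgHom.comp_apply, AlgHom.comp_apply, h1, h2, hy']
      ring
    simp only [this]
    rw [aeval_const_mul_of_isHomogeneous hp, ha]
  have hleft : ψ.comp (α'.comp valHom) = RingHom.id _ := by
    refine RingHom.ext fun x ↦ ?_
    obtain ⟨r, p, hp, rfl⟩ := Away.mk_surjective _ hf x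
    apply valHom_inj
    have h1 : valHom (Away.mk _ hf r p hp) = a p * u ^ r := val_awayMk hf r p hp
    have h2 : valA (ψA (Polynomial.C z)) = a l ^ (1 + e) * u := by
      rw [← hζ, ← hφz]; exact congrArg valA (hψC _)
    simp only [RingHom.comp_apply, RingHom.id_apply, h1, map_mul, map_pow, hα', hα'u]
    refine (congrArg₂ (fun s t ↦ s * t ^ r) (hψα p _ hp) h2).trans ?_
    calc (a g * u) ^ (r • (1 + e)) * a p * (a l ^ (1 + e) * u) ^ r
        = ((a l * a g * u) ^ (1 + e)) ^ r * (a p * u ^ r) := by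
          rw [smul_eq_mul]; ring
      _ = a p * u ^ r := by rw [hlgu, one_pow, one_pow, one_mul]
  have hαg : α g * Polynomial.C z = 1 := by
    rw [hα g hgv, ← Polynomial.C_mul, hyg, Polynomial.C_1]
  have hαξ : ∀ p hp, α' (valHom (ξ p hp)) = α p := fun p hp ↦ by
    rw [hξ p hp, map_mul, map_mul, hα', hα', hα'u, mul_assoc, hαg, mul_one]
  have hαX : ∀ i, α (X i) = Polynomial.C (y i) +
      Polynomial.X * algebraMap k (Polynomial B) (v i) := fun i ↦ aeval_X _ _
  have hαm : α (X m) = Polynomial.X := by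
    rw [hαX, hv, hym, map_one, map_zero, zero_add, mul_one]
  have hα'c : ∀ c, α' (algebraMap k _ c) = algebraMap k _ c := fun c ↦ by
    have := hα' (C c)
    rw [show a (C c) = algebraMap k (Localization.Away f) c from a.commutes c] at this
    exact this.trans (α.commutes c)
  let αA : Localization.Away f →ₐ[k] Polynomial B := { α' with commutes' := hα'c }
  have hCφ : (αA.comp valA).comp φ = Polynomial.CAlgHom := by
    refine hext _ _ _ (fun i ↦ ?_) ?_
    · rw [AlgHom.comp_apply, hφy]
      refine (hαξ _ (hYh i)).trans ?_
      have : α (C (v i)) = algebraMap k (Polynomial B) (v i) := α.commutes _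
      rw [map_sub, map_mul, this, hαm, hαX]
      change _ = Polynomial.C (y i)
      ring
    · rw [AlgHom.comp_apply, hφz]
      refine (congrArg α' hζ).trans ?_
      rw [map_mul, map_pow, hα', hα'u, hα l hlT, hyl, Polynomial.C_1, one_pow, one_mul]
      rfl
  have hright : (α'.comp valHom).comp ψ = RingHom.id _ := by
    refine Polynomial.ringHom_ext (fun b ↦ ?_) ?_
    · rw [RingHom.comp_apply, hψC]
      exact congr($hCφ b)
    · rw [RingHom.comp_apply, hψX, RingHom.comp_apply, hαξ _ (hX m), hαm]
      rfl
  refine ⟨B, _, _, hB, RingEquiv.ofRingHom ψ (α'.comp valHom) hleft hright, fun c ↦ ?_⟩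
  exact (hψC _).trans (φ.commutes c)

end Charts

section AffineClass

open TensorProduct

/-- The class of the affine line over an affine scheme of finite type is a multiple of `𝕃`. -/
lemma MotivicMeasure.cl_spec_mem_span_lef {k : Type u} [Field k] {R : Type v} [CommRing R]
    (μ : MotivicMeasure k R) {B S : Type u} [CommRing B] [Algebra k B] [Algebra.FiniteType k B]
    [CommRing S] (σ : k →+* S) (E : Polynomial B ≃+* S)
    (hE : ∀ c, E (Polynomial.C (algebraMap k B c)) = σ c) :
    μ.cl (Spec (.of S)) (Spec.map (CommRingCat.ofHom σ)) ∈ Ideal.span {μ.lef} := by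
  let sB : Spec (.of B) ⟶ SpecBase k := Spec.map (CommRingCat.ofHom (algebraMap k B))
  have hsB : LocallyOfFiniteType sB := by
    rw [HasRingHomProperty.Spec_iff (P := @LocallyOfFiniteType)]
    exact (RingHom.finiteType_algebraMap (A := k) (B := B)).mpr inferInstance
  let sA : Spec (.of (Polynomial k)) ⟶ SpecBase k :=
    Spec.map (CommRingCat.ofHom (algebraMap k (Polynomial k)))
  have hsA : LocallyOfFiniteType sA := by
    rw [HasRingHomProperty.Spec_iff (P := @LocallyOfFiniteType)]
    exact (RingHom.finiteType_algebraMap (A := k) (B := Polynomial k)).mpr inferInstance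
  have hσ : LocallyOfFiniteType (Spec.map (CommRingCat.ofHom σ)) := by
    let _ : Algebra k S := σ.toAlgebra
    let EA : Polynomial B ≃ₐ[k] S := AlgEquiv.ofRingEquiv (f := E) hE
    rw [HasRingHomProperty.Spec_iff (P := @LocallyOfFiniteType)]
    exact (RingHom.finiteType_algebraMap (A := k) (B := S)).mpr (Algebra.FiniteType.equiv
      (Algebra.FiniteType.trans (S := B) inferInstance inferInstance) EA)
  have hprod := μ.cl_prod sB sA hsB inferInstance inferInstance hsA inferInstance inferInstance
  let T : B ⊗[k] Polynomial k ≃+* S :=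
    (polyEquivTensor k B).symm.toRingEquiv.trans E
  let e : Spec (.of S) ≅ pullback sB sA :=
    Scheme.Spec.mapIso T.toCommRingCatIso.op ≪≫ (pullbackSpecIso k B (Polynomial k)).symm
  have he : e.hom ≫ pullback.fst sB sA ≫ sB =
      Spec.map (CommRingCat.ofHom σ) := by
    have h1 : e.hom = Spec.map (CommRingCat.ofHom T.toRingHom) ≫
        (pullbackSpecIso k B (Polynomial k)).inv := rfl
    rw [h1, Category.assoc, pullbackSpecIso_inv_fst_assoc, ← Spec.map_comp, ← Spec.map_comp,
      ← CommRingCat.ofHom_comp, ← CommRingCat.ofHom_comp]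
    congr 2
    ext c
    rw [← hE]
    change E ((polyEquivTensor k B).symm (algebraMap k B c ⊗ₜ 1)) = _
    rw [polyEquivTensor_symm_apply_tmul_eq_smul, Polynomial.map_one, Polynomial.smul_eq_C_mul,
      mul_one]
  rw [μ.cl_iso _ _ e hσ inferInstance inferInstance he, hprod]
  exact Ideal.mul_mem_left _ _ (Ideal.mem_span_singleton_self _)

end AffineClass

section ProjectiveSpace

open HomogeneousLocalization

attribute [local instance] MvPolynomial.gradedAlgebra

variable {k : Type u} [Field k] {n : ℕ}

lemma algebraMap_homogeneousSubmodule_zero_surjective {σ : Type*} :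
    Function.Surjective (algebraMap k (homogeneousSubmodule σ k 0)) := by
  rintro ⟨p, hp⟩
  have hp' := hp
  rw [homogeneousSubmodule_zero, Submodule.mem_one] at hp'
  obtain ⟨c, hc⟩ := hp'
  exact ⟨c, Subtype.ext hc⟩

instance finiteType_homogeneousSubmodule_zero :
    Algebra.FiniteType (homogeneousSubmodule (Fin (n + 1)) k 0) (MvPolynomial (Fin (n + 1)) k) :=
  have : IsScalarTower k (homogeneousSubmodule (Fin (n + 1)) k 0)
      (MvPolynomial (Fin (n + 1)) k) := .of_algebraMap_eq (R := k)
      (S := homogeneousSubmodule (Fin (n + 1)) k 0) (A := MvPolynomial (Fin (n + 1)) k) fun _ ↦ rfl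
  .of_restrictScalars_finiteType k _ _

instance isClosedImmersion_Spec_homogeneousSubmodule_zero :
    IsClosedImmersion (Spec.map (CommRingCat.ofHom
      (algebraMap k (homogeneousSubmodule (Fin (n + 1)) k 0)))) :=
  IsClosedImmersion.spec_of_surjective _ algebraMap_homogeneousSubmodule_zero_surjective

instance locallyOfFiniteType_projSpace_toSpec : LocallyOfFiniteType (ProjSpace.toSpec k n) :=
  inferInstanceAs (LocallyOfFiniteType (Proj.toSpecZero (homogeneousSubmodule (Fin (n + 1)) k) ≫
    Spec.map (CommRingCat.ofHom (algebraMap k (homogeneousSubmodule (Fin (n + 1)) k 0)))))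

instance quasiCompact_projSpace_toSpec : QuasiCompact (ProjSpace.toSpec k n) :=
  inferInstanceAs (QuasiCompact (Proj.toSpecZero (homogeneousSubmodule (Fin (n + 1)) k) ≫
    Spec.map (CommRingCat.ofHom (algebraMap k (homogeneousSubmodule (Fin (n + 1)) k 0)))))

instance isSeparated_projSpace_toSpec : IsSeparated (ProjSpace.toSpec k n) :=
  inferInstanceAs (IsSeparated (Proj.toSpecZero (homogeneousSubmodule (Fin (n + 1)) k) ≫
    Spec.map (CommRingCat.ofHom (algebraMap k (homogeneousSubmodule (Fin (n + 1)) k 0)))))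

lemma awayι_projSpace_toSpec {f : MvPolynomial (Fin (n + 1)) k} {e : ℕ}
    (hf : f ∈ homogeneousSubmodule (Fin (n + 1)) k e) (he : 0 < e) :
    Proj.awayι (homogeneousSubmodule (Fin (n + 1)) k) f hf he ≫ ProjSpace.toSpec k n =
      Spec.map (CommRingCat.ofHom (awayAlgebraMap f)) := by
  rw [ProjSpace.toSpec]
  refine (Proj.awayι_toSpecZero_assoc _ _ hf he _).trans ?_
  rw [← Spec.map_comp]
  rfl

/-- The basic open `D₊(f)` in projective space. -/
noncomputable def ProjSpace.basicOpen (f : MvPolynomial (Fin (n + 1)) k) : (ProjSpace k n).Opens :=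
  Proj.basicOpen (homogeneousSubmodule (Fin (n + 1)) k) f

lemma MotivicMeasure.clOpen_basicOpen_mem {R : Type v} [CommRing R] (μ : MotivicMeasure k R)
    {v : Fin (n + 1) → k} {m : Fin (n + 1)} (hv : v m = 1)
    {l g : MvPolynomial (Fin (n + 1)) k} {e : ℕ} (hl : l.IsHomogeneous 1) (hlv : eval v l = 0)
    (hg : g.IsHomogeneous e) (hgv : g.IsTranslationInvariant v) :
    μ.clOpen (ProjSpace.toSpec k n) (ProjSpace.basicOpen (l * g)) ∈ Ideal.span {μ.lef} := by
  obtain ⟨B, _, _, _, E, hE⟩ := exists_away_equiv_polynomial v m hv hl hlv hg hgv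
  have hf : l * g ∈ homogeneousSubmodule (Fin (n + 1)) k (1 + e) := hl.mul hg
  have he : 0 < 1 + e := by lia
  let j : Spec (.of (Away (homogeneousSubmodule (Fin (n + 1)) k) (l * g))) ⟶ ProjSpace k n :=
    Proj.awayι (homogeneousSubmodule (Fin (n + 1)) k) (l * g) hf he
  have hjo : IsOpenImmersion j :=
    inferInstanceAs (IsOpenImmersion
      (Proj.awayι (homogeneousSubmodule (Fin (n + 1)) k) (l * g) hf he))
  have hj : j.opensRange = ProjSpace.basicOpen (l * g) :=
    Proj.opensRange_awayι (homogeneousSubmodule (Fin (n + 1)) k) (l * g) hf he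
  have hs : j ≫ ProjSpace.toSpec k n = Spec.map (CommRingCat.ofHom (awayAlgebraMap (l * g))) :=
    awayι_projSpace_toSpec hf he
  rw [← hj, clOpen_opensRange, hs]
  exact μ.cl_spec_mem_span_lef _ E hE

end ProjectiveSpace

section RationalPoint

open HomogeneousLocalization

attribute [local instance] MvPolynomial.gradedAlgebra

variable {k : Type u} [Field k] {n : ℕ}

/-- The linear form `xᵢ - vᵢ xₘ`, which vanishes at `v` if `vₘ = 1`. -/
noncomputable def linearFormThrough (v : Fin (n + 1) → k) (m i : Fin (n + 1)) :
    MvPolynomial (Fin (n + 1)) k :=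
  X i - C (v i) * X m

lemma isHomogeneous_linearFormThrough (v : Fin (n + 1) → k) (m i : Fin (n + 1)) :
    (linearFormThrough v m i).IsHomogeneous 1 :=
  (isHomogeneous_X k i).sub ((isHomogeneous_X k m).C_mul _)

lemma eval_linearFormThrough {v : Fin (n + 1) → k} {m : Fin (n + 1)} (hv : v m = 1)
    (i : Fin (n + 1)) : eval v (linearFormThrough v m i) = 0 := by
  simp [linearFormThrough, hv]

variable (v : Fin (n + 1) → k) (m : Fin (n + 1)) (hv : v m = 1)

/-- Evaluation at `v` of fractions with denominator a power of `xₘ`, where `vₘ = 1`. -/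
noncomputable def evalLocalization :
    Localization.Away (X m : MvPolynomial (Fin (n + 1)) k) →+* k :=
  IsLocalization.Away.lift (X m) (g := eval v) (by simp [hv])

lemma evalLocalization_algebraMap (p : MvPolynomial (Fin (n + 1)) k) :
    evalLocalization v m hv (algebraMap (MvPolynomial (Fin (n + 1)) k) _ p) = eval v p :=
  IsLocalization.Away.lift_eq _ _ _

/-- Evaluation at `v` of homogeneous fractions of degree zero whose denominator is a power of `xₘ`,
where `vₘ = 1`. -/
noncomputable def evalAway :
    Away (homogeneousSubmodule (Fin (n + 1)) k) (X m : MvPolynomial (Fin (n + 1)) k) →+* k :=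
  (evalLocalization v m hv).comp (algebraMap _ _)

lemma X_mem_homogeneousSubmodule (i : Fin (n + 1)) :
    (X i : MvPolynomial (Fin (n + 1)) k) ∈ homogeneousSubmodule (Fin (n + 1)) k 1 :=
  isHomogeneous_X k i

lemma evalAway_mk (r : ℕ) (x : MvPolynomial (Fin (n + 1)) k)
    (hx : x ∈ homogeneousSubmodule (Fin (n + 1)) k (r • 1)) :
    evalAway v m hv (Away.mk _ (X_mem_homogeneousSubmodule m) r x hx) = eval v x := by
  have hu : evalLocalization v m hv
      (IsLocalization.Away.invSelf (X m : MvPolynomial (Fin (n + 1)) k)) = 1 := by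
    have := congrArg (evalLocalization v m hv) (IsLocalization.Away.mul_invSelf
      (S := Localization.Away (X m : MvPolynomial (Fin (n + 1)) k)) (X m : MvPolynomial (Fin (n + 1)) k))
    rwa [map_mul, map_one, evalLocalization_algebraMap, eval_X, hv, one_mul] at this
  have := congrArg (evalLocalization v m hv) (val_awayMk (X_mem_homogeneousSubmodule m) r x hx)
  rw [map_mul, map_pow, hu, one_pow, mul_one, evalLocalization_algebraMap] at this
  exact this

lemma evalAway_awayAlgebraMap (c : k) : evalAway v m hv (awayAlgebraMap _ c) = c := by
  refine (congrArg (evalLocalization v m hv) (val_awayAlgebraMap (X m) c)).trans ?_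
  exact (evalLocalization_algebraMap v m hv _).trans (eval_C c)

/-- The kernel of the evaluation at `v` is generated by the fractions `(xᵢ - vᵢ xₘ) / xₘ`. -/
lemma ker_evalAway_le (J : Ideal (Away (homogeneousSubmodule (Fin (n + 1)) k)
      (X m : MvPolynomial (Fin (n + 1)) k)))
    (hJ : ∀ i, Away.mk _ (X_mem_homogeneousSubmodule m) 1 (linearFormThrough v m i)
      (isHomogeneous_linearFormThrough v m i) ∈ J) :
    RingHom.ker (evalAway v m hv) ≤ J := by
  let 𝒜 := homogeneousSubmodule (Fin (n + 1)) k
  let x : MvPolynomial (Fin (n + 1)) k := X m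
  let _ : Algebra k (Away 𝒜 x) := (awayAlgebraMap x).toAlgebra
  let val : Away 𝒜 x →ₐ[k] Localization.Away x :=
    { (algebraMap _ _ : Away 𝒜 x →+* Localization.Away x) with
      commutes' := fun c ↦ (val_awayAlgebraMap x c).trans
        (IsScalarTower.algebraMap_apply k (MvPolynomial (Fin (n + 1)) k) _ c).symm }
  have val_inj : Function.Injective val := val_injective _
  let a : MvPolynomial (Fin (n + 1)) k →ₐ[k] Localization.Away x := Algebra.algHom _ _ _
  have ha : ∀ p, aeval (fun i ↦ a (X i)) p = a p := fun p ↦ congr($(aeval_unique a) p).symm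
  let y : Fin (n + 1) → Away 𝒜 x := fun i ↦
    Away.mk 𝒜 (X_mem_homogeneousSubmodule m) 1 (X i) (X_mem_homogeneousSubmodule i)
  have hmk : ∀ (r : ℕ) (p : MvPolynomial (Fin (n + 1)) k) (hp : p ∈ 𝒜 (r • 1)),
      Away.mk 𝒜 (X_mem_homogeneousSubmodule m) r p hp = aeval y p := fun r p hp ↦ by
    apply val_inj
    rw [← AlgHom.comp_apply, comp_aeval]
    have hy : ∀ i, val (y i) = IsLocalization.Away.invSelf x * a (X i) := fun i ↦ by
      refine (val_awayMk (X_mem_homogeneousSubmodule m) 1 (X i)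
        (X_mem_homogeneousSubmodule i)).trans ?_
      rw [pow_one, mul_comm]
      rfl
    simp only [hy]
    have hp' : p.IsHomogeneous r := by simpa [𝒜] using hp
    rw [aeval_const_mul_of_isHomogeneous hp', ha, mul_comm]
    exact val_awayMk (X_mem_homogeneousSubmodule m) r p hp
  have hyJ : ∀ i, Ideal.Quotient.mkₐ k J (y i) = algebraMap k _ (v i) := fun i ↦ by
    have h1 := Ideal.Quotient.eq_zero_iff_mem.mpr (hJ i)
    have h2 : aeval y (linearFormThrough v m i) = y i - algebraMap k _ (v i) := by
      have : y m = 1 := by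
        apply val_inj
        rw [map_one]
        refine (val_awayMk (X_mem_homogeneousSubmodule m) 1 (X m)
          (X_mem_homogeneousSubmodule m)).trans ?_
        rw [pow_one]
        exact IsLocalization.Away.mul_invSelf _
      simp [linearFormThrough, this]
    have h3 := (congrArg (Ideal.Quotient.mkₐ k J) ((hmk 1 _
      (isHomogeneous_linearFormThrough v m i)).trans h2)).symm.trans h1
    rwa [map_sub, sub_eq_zero] at h3
  intro w hw
  obtain ⟨r, p, hp, rfl⟩ := Away.mk_surjective 𝒜 (X_mem_homogeneousSubmodule m) w
  rw [RingHom.mem_ker, evalAway_mk] at hw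
  refine Ideal.Quotient.eq_zero_iff_mem.mp ?_
  refine (congrArg (Ideal.Quotient.mkₐ k J) (hmk r p hp)).trans ?_
  rw [← AlgHom.comp_apply, comp_aeval]
  simp only [hyJ]
  have : aeval (fun i ↦ algebraMap k (Away 𝒜 x ⧸ J) (v i)) p = algebraMap k _ (eval v p) := by
    rw [← aeval_eq_eval]
    exact aeval_algebraMap_apply _ _ _
  rw [this, hw, map_zero]

/-- The `k`-rational point of projective space with homogeneous coordinates `v`. -/
noncomputable def ProjSpace.point : SpecBase k ⟶ ProjSpace k n :=
  Spec.map (CommRingCat.ofHom (evalAway v m hv)) ≫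
    Proj.awayι (homogeneousSubmodule (Fin (n + 1)) k) (X m) (X_mem_homogeneousSubmodule m) one_pos

lemma ProjSpace.point_toSpec : ProjSpace.point v m hv ≫ ProjSpace.toSpec k n = 𝟙 _ := by
  rw [ProjSpace.point]
  refine (Category.assoc _ _ _).trans ?_
  refine (congrArg (Spec.map (CommRingCat.ofHom (evalAway v m hv)) ≫ ·)
    (awayι_projSpace_toSpec (X_mem_homogeneousSubmodule m) one_pos)).trans ?_
  rw [← Spec.map_comp, ← CommRingCat.ofHom_comp]
  have : (evalAway v m hv).comp (awayAlgebraMap _) = RingHom.id k :=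
    RingHom.ext (evalAway_awayAlgebraMap v m hv)
  rw [this]
  exact Spec.map_id _

instance isClosedImmersion_projSpace_point : IsClosedImmersion (ProjSpace.point v m hv) :=
  have : IsClosedImmersion (ProjSpace.point v m hv ≫ ProjSpace.toSpec k n) := by
    rw [ProjSpace.point_toSpec]; infer_instance
  .of_comp _ (ProjSpace.toSpec k n)

lemma ProjSpace.exists_mem_basicOpen_X (q : ProjSpace k n) :
    ∃ i, q ∈ ProjSpace.basicOpen (X i : MvPolynomial (Fin (n + 1)) k) := by
  have h := Proj.iSup_basicOpen_eq_top' (homogeneousSubmodule (Fin (n + 1)) k)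
    (fun i : Fin (n + 1) ↦ (X i : MvPolynomial (Fin (n + 1)) k))
    (fun i ↦ ⟨1, isHomogeneous_X k i⟩) ?_
  · have hq : q ∈ (⊤ : (ProjSpace k n).Opens) := trivial
    exact TopologicalSpace.Opens.mem_iSup.mp (h.ge hq)
  · refine top_le_iff.mp fun p _ ↦ ?_
    induction p using MvPolynomial.induction_on with
    | C c =>
      exact Subalgebra.algebraMap_mem (Algebra.adjoin (homogeneousSubmodule (Fin (n + 1)) k 0)
        (Set.range fun i ↦ (X i : MvPolynomial (Fin (n + 1)) k)))
        (algebraMap k (homogeneousSubmodule (Fin (n + 1)) k 0) c)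
    | add p q hp hq => exact add_mem (hp trivial) (hq trivial)
    | mul_X p i hp => exact mul_mem (hp trivial) (Algebra.subset_adjoin ⟨i, rfl⟩)

lemma ProjSpace.range_point : Set.range (ProjSpace.point v m hv) =
    {q | ∀ i, q ∉ ProjSpace.basicOpen (linearFormThrough v m i)} := by
  let 𝒜 := homogeneousSubmodule (Fin (n + 1)) k
  let j := Proj.awayι 𝒜 (X m) (X_mem_homogeneousSubmodule m) one_pos
  let t : Fin (n + 1) → Away 𝒜 (X m : MvPolynomial (Fin (n + 1)) k) := fun i ↦
    Away.mk 𝒜 (X_mem_homogeneousSubmodule m) 1 (linearFormThrough v m i)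
      (isHomogeneous_linearFormThrough v m i)
  have ht : ∀ i, evalAway v m hv (t i) = 0 := fun i ↦
    (evalAway_mk v m hv _ _ _).trans (eval_linearFormThrough hv i)
  have hpre : ∀ i (r : PrimeSpectrum (Away 𝒜 (X m : MvPolynomial (Fin (n + 1)) k))),
      j r ∈ ProjSpace.basicOpen (linearFormThrough v m i) ↔ t i ∉ r.asIdeal := fun i r ↦ by
    have h := Proj.awayι_preimage_basicOpen 𝒜 (X_mem_homogeneousSubmodule m) one_pos
      (isHomogeneous_linearFormThrough v m i) one_pos
    have h' : t i = Away.isLocalizationElem (X_mem_homogeneousSubmodule m)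
        (isHomogeneous_linearFormThrough v m i) := by
      simp only [t, Away.isLocalizationElem, pow_one]
      rfl
    rw [h']
    exact congr(r ∈ $h).to_iff
  ext q
  constructor
  · rintro ⟨s, rfl⟩ i hi
    refine (hpre i (PrimeSpectrum.comap (evalAway v m hv) s)).mp hi ?_
    change evalAway v m hv (t i) ∈ s.asIdeal
    rw [ht]
    exact s.asIdeal.zero_mem
  · intro hq
    have hqm : q ∈ ProjSpace.basicOpen (X m : MvPolynomial (Fin (n + 1)) k) := by
      by_contra hqm
      obtain ⟨i, hi⟩ := ProjSpace.exists_mem_basicOpen_X q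
      refine hi ?_
      have h1 : X m ∈ q.asHomogeneousIdeal := not_not.mp hqm
      have h2 : linearFormThrough v m i ∈ q.asHomogeneousIdeal := not_not.mp (hq i)
      have h3 := q.asHomogeneousIdeal.toIdeal.add_mem h2
        (q.asHomogeneousIdeal.toIdeal.mul_mem_left (C (v i)) h1)
      rwa [linearFormThrough, sub_add_cancel] at h3
    obtain ⟨r, rfl⟩ : q ∈ j.opensRange := by
      rw [Proj.opensRange_awayι]
      exact hqm
    have hr := ker_evalAway_le v m hv r.asIdeal fun i ↦ not_not.mp (mt (hpre i r).mpr (hq i))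
    have hmax : (RingHom.ker (evalAway v m hv)).IsMaximal :=
      RingHom.ker_isMaximal_of_surjective _ fun c ↦ ⟨_, evalAway_awayAlgebraMap v m hv c⟩
    refine ⟨(⊥ : PrimeSpectrum k), congrArg j ?_⟩
    refine PrimeSpectrum.ext ?_
    exact hmax.eq_of_le r.isPrime.ne_top hr

end RationalPoint

section CommonZero

variable {k : Type u} [Field k] {n d : ℕ}

/-- Evaluation of finitely many linear forms, as a linear map. -/
noncomputable def evalLinearForms (h : Fin d → MvPolynomial (Fin (n + 1)) k)
    (hh : ∀ i, (h i).IsHomogeneous 1) : (Fin (n + 1) → k) →ₗ[k] (Fin d → k) where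
  toFun v i := eval v (h i)
  map_add' v w := funext fun i ↦ aeval_add_of_isHomogeneous_one (S := k) (hh i) v w
  map_smul' c v := funext fun i ↦
    (aeval_const_mul_of_isHomogeneous (S := k) (hh i) c v).trans (by simp [aeval_eq_eval])

lemma exists_common_zero_of_isHomogeneous_one (hdn : d ≤ n)
    (h : Fin d → MvPolynomial (Fin (n + 1)) k) (hh : ∀ i, (h i).IsHomogeneous 1) :
    ∃ (v : Fin (n + 1) → k) (m : Fin (n + 1)), v m = 1 ∧ ∀ i, eval v (h i) = 0 := by
  have hker := LinearMap.ker_ne_bot_of_finrank_lt (f := evalLinearForms h hh)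
    (by simpa using Nat.lt_succ_of_le hdn)
  obtain ⟨w, hw, hw0⟩ := Submodule.exists_mem_ne_zero_of_ne_bot hker
  obtain ⟨m, hm⟩ := Function.ne_iff.mp hw0
  refine ⟨(w m)⁻¹ • w, m, inv_mul_cancel₀ hm, fun i ↦ ?_⟩
  exact congrFun ((LinearMap.ker _).smul_mem (w m)⁻¹ hw) i

end CommonZero

section PuncturedProjectiveSpace

attribute [local instance] MvPolynomial.gradedAlgebra

variable {k : Type u} [Field k] {n : ℕ} {R : Type v} [CommRing R] (μ : MotivicMeasure k R)

lemma ProjSpace.basicOpen_mul (f g : MvPolynomial (Fin (n + 1)) k) :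
    ProjSpace.basicOpen (f * g) = ProjSpace.basicOpen f ⊓ ProjSpace.basicOpen g :=
  Proj.basicOpen_mul (homogeneousSubmodule (Fin (n + 1)) k) f g

lemma ProjSpace.coe_basicOpen (f : MvPolynomial (Fin (n + 1)) k) :
    (ProjSpace.basicOpen f : Set (ProjSpace k n)) =
      (ProjectiveSpectrum.zeroLocus (homogeneousSubmodule (Fin (n + 1)) k) {f})ᶜ :=
  ProjectiveSpectrum.basicOpen_eq_zeroLocus_compl _ _

lemma MotivicMeasure.clOpen_sup_linearFormThrough_mem {v : Fin (n + 1) → k} {m : Fin (n + 1)}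
    (hv : v m = 1) :
    μ.clOpen (ProjSpace.toSpec k n)
      (Finset.univ.sup fun i ↦ ProjSpace.basicOpen (linearFormThrough v m i)) ∈
        Ideal.span {μ.lef} := by
  refine μ.clOpen_finset_sup_mem _ _ {V | ∃ (l g : MvPolynomial (Fin (n + 1)) k) (e : ℕ),
    l.IsHomogeneous 1 ∧ eval v l = 0 ∧ g.IsHomogeneous e ∧ g.IsTranslationInvariant v ∧
      V = ProjSpace.basicOpen (l * g)} ?_ ?_ _ _ ?_
  · rintro _ ⟨l, g, e, hl, hlv, hg, hgv, rfl⟩ _ ⟨l', g', e', hl', hlv', hg', hgv', rfl⟩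
    refine ⟨l, g * (l' * g'), _, hl, hlv, hg.mul (hl'.mul hg'),
      hgv.mul ((isTranslationInvariant_of_isHomogeneous_one hl' hlv').mul hgv'), ?_⟩
    rw [← mul_assoc, ProjSpace.basicOpen_mul (l * g)]
  · rintro _ ⟨l, g, e, hl, hlv, hg, hgv, rfl⟩
    exact μ.clOpen_basicOpen_mem hv hl hlv hg hgv
  · intro i _
    refine ⟨linearFormThrough v m i, 1, 0, isHomogeneous_linearFormThrough v m i,
      eval_linearFormThrough hv i, isHomogeneous_one _ _, ?_, by rw [mul_one]⟩
    intro S _ _ y t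
    rw [map_one, map_one]

lemma MotivicMeasure.cl_projSpace_sub_one_mem :
    μ.cl (ProjSpace k n) (ProjSpace.toSpec k n) - 1 ∈ Ideal.span {μ.lef} := by
  let v : Fin (n + 1) → k := fun _ ↦ 1
  have hv : v 0 = 1 := rfl
  have h := μ.cl_scissor (ProjSpace.toSpec k n) (ProjSpace.point v 0 hv) inferInstance
    inferInstance inferInstance inferInstance
    (Finset.univ.sup fun i ↦ ProjSpace.basicOpen (linearFormThrough v 0 i)) (by
      refine Eq.trans ?_ (congrArg (·ᶜ) (ProjSpace.range_point v 0 hv)).symm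
      ext q
      simp [Finset.sup_eq_iSup])
  rw [ProjSpace.point_toSpec, μ.cl_point] at h
  rw [h, add_sub_cancel_right]
  exact μ.clOpen_sup_linearFormThrough_mem hv

end PuncturedProjectiveSpace

/-- Let `k` be any field and let `X := V(h₁ ⋯ h_d) ⊂ ℙⁿ_k` be a
hypersurface of degree `d ≤ n`, where `h₁, …, h_d` are homogeneous polynomials of degree 1
(so `X` is a union of `d` hyperplanes).  Then `[X] ≡ 1 mod 𝕃` in `K₀(Var_k)`. -/
theorem union_of_hyperplanes_class_eq_one (k : Type u) [Field k] (n d : ℕ)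
    (hd : 1 ≤ d) (hdn : d ≤ n)
    (h : Fin d → MvPolynomial (Fin (n + 1)) k)
    (hh : ∀ i, (h i).IsHomogeneous 1) (hh0 : ∀ i, h i ≠ 0)
    (X : Scheme.{u}) (sX : X ⟶ SpecBase k)
    (hX : IsProjSubvariety k n {∏ i, h i} X sX) :
    ∀ (R : Type u) [CommRing R] (μ : MotivicMeasure k R),
      μ.cl X sX - 1 ∈ Ideal.span {μ.lef} := by
  intro R _ μ
  obtain ⟨v, m, hv, hhv⟩ := exists_common_zero_of_isHomogeneous_one hdn h hh
  obtain ⟨-, i, hi, rfl, hrange⟩ := hX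
  let i₀ : Fin d := ⟨0, hd⟩
  have hsplit := Finset.mul_prod_erase Finset.univ h (Finset.mem_univ i₀)
  have hmem : μ.clOpen (ProjSpace.toSpec k n) (ProjSpace.basicOpen (∏ i, h i)) ∈
      Ideal.span {μ.lef} := by
    rw [← hsplit]
    exact μ.clOpen_basicOpen_mem hv (hh i₀) (hhv i₀)
      (IsHomogeneous.prod _ h (fun _ ↦ 1) fun j _ ↦ hh j)
      (.prod _ fun j _ ↦ isTranslationInvariant_of_isHomogeneous_one (hh j) (hhv j))
  have hX' := μ.cl_scissor (ProjSpace.toSpec k n) i inferInstance inferInstance inferInstance hi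
    (ProjSpace.basicOpen (∏ i, h i)) (by
      rw [hrange]
      exact ProjSpace.coe_basicOpen _)
  have key : μ.cl X (i ≫ ProjSpace.toSpec k n) - 1 =
      (μ.cl (ProjSpace k n) (ProjSpace.toSpec k n) - 1) -
        μ.clOpen (ProjSpace.toSpec k n) (ProjSpace.basicOpen (∏ i, h i)) := by
    rw [hX']
    ring
  rw [key]
  exact Ideal.sub_mem _ μ.cl_projSpace_sub_one_mem hmem
end

section
/- Let k be any field, let h₁,…,h_d ∈ k[x₀,…,xₙ] be homogeneous polynomials of degree 1 with d ≤ n, let X := V(h₁⋯h_d) ⊂ ℙⁿ_k, let Y := ⋂ᵢ V(hᵢ) (a linear subspace of codimension r ≤ d), and after a linear change of coordinates write f := h₁⋯h_d ∈ k[x₀,…,x_{r−1}] and Z := V(f) ⊂ ℙ^{r−1}_k. Then [X] = 1 + 𝕃 + ⋯ + 𝕃^{n−r} + 𝕃^{n−r+1}·[Z] in K₀(Var_k). -/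
open AlgebraicGeometry CategoryTheory CategoryTheory.Limits MvPolynomial

universe u v

noncomputable section

attribute [local instance] MvPolynomial.gradedAlgebra

end

noncomputable section

attribute [local instance] MvPolynomial.gradedAlgebra

namespace MotivicMeasure

variable {k : Type u} [Field k] {R : Type v} [CommRing R] (μ : MotivicMeasure k R)

theorem cl_eq_zero_of_isEmpty {X : Scheme.{u}} (sX : X ⟶ SpecBase k) [IsEmpty X] :
    μ.cl X sX = 0 := by
  have : IsClosedImmersion (𝟙 X) := inferInstance
  have hU : (((⊤ : X.Opens) : Set X)) = (Set.range (𝟙 X : X ⟶ X).base)ᶜ := by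
    ext x; exact isEmptyElim x
  have h := μ.cl_scissor sX (𝟙 X) inferInstance inferInstance inferInstance inferInstance ⊤ hU
  have h2 := μ.cl_iso ((⊤ : X.Opens).ι ≫ sX) sX (asIso (Scheme.Opens.ι ⊤)) inferInstance
    inferInstance inferInstance rfl
  simpa [h2] using h

theorem cl_eq_of_surjective {X Z : Scheme.{u}} (sX : X ⟶ SpecBase k) (i : Z ⟶ X)
    [LocallyOfFiniteType sX] [QuasiCompact sX] [IsSeparated sX]
    [IsClosedImmersion i] [Surjective i] : μ.cl X sX = μ.cl Z (i ≫ sX) := by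
  have h := μ.cl_scissor sX i inferInstance inferInstance inferInstance inferInstance ⊥
    (by rw [Set.range_eq_univ.mpr (i.surjective)]; simp)
  have : IsEmpty (⊥ : X.Opens).toScheme := ⟨fun x => x.2⟩
  rw [h, μ.cl_eq_zero_of_isEmpty, zero_add]

section Immersion

variable {P X Y W : Scheme.{u}} (sP : P ⟶ SpecBase k) [LocallyOfFiniteType sP] [IsSeparated sP]

theorem _root_.AlgebraicGeometry.IsImmersion.isClosedImmersion_of_isClosed_range
    {X Y : Scheme.{u}} (f : X ⟶ Y) [IsImmersion f] (h : IsClosed (Set.range f)) :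
    IsClosedImmersion f :=
  .of_isPreimmersion f h

theorem cl_eq_cl_pullback_of_range_subset (a : X ⟶ P) (b : Y ⟶ P) [IsImmersion a] [IsImmersion b]
    [CompactSpace X] (h : Set.range a ⊆ Set.range b) :
    μ.cl X (a ≫ sP) = μ.cl (pullback a b) (pullback.fst a b ≫ a ≫ sP) := by
  have hr : Set.range (pullback.fst a b) = Set.univ := by
    rw [Scheme.Pullback.range_fst]
    exact Set.eq_univ_of_forall fun x => h ⟨x, rfl⟩
  have : IsClosedImmersion (pullback.fst a b) :=
    IsImmersion.isClosedImmersion_of_isClosed_range _ (hr ▸ isClosed_univ)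
  have : Surjective (pullback.fst a b) := ⟨Set.range_eq_univ.mp hr⟩
  exact μ.cl_eq_of_surjective _ _

theorem cl_eq_of_range_eq (a : X ⟶ P) (b : Y ⟶ P) [IsImmersion a] [IsImmersion b]
    [CompactSpace X] [CompactSpace Y] (h : Set.range a = Set.range b) :
    μ.cl X (a ≫ sP) = μ.cl Y (b ≫ sP) := by
  rw [μ.cl_eq_cl_pullback_of_range_subset sP a b h.subset, μ.cl_eq_cl_pullback_of_range_subset sP b a h.superset]
  have h1 : CompactSpace ↥(pullback a b) := by
    have hr : Set.range (pullback.fst a b) = Set.univ := by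
      rw [Scheme.Pullback.range_fst]
      exact Set.eq_univ_of_forall fun x => h.subset ⟨x, rfl⟩
    have : IsClosedImmersion (pullback.fst a b) :=
      IsImmersion.isClosedImmersion_of_isClosed_range _ (hr ▸ isClosed_univ)
    exact (pullback.fst a b).isClosedEmbedding.compactSpace
  refine μ.cl_iso _ _ (pullbackSymmetry a b) inferInstance inferInstance inferInstance ?_
  simp [pullback.condition_assoc]

theorem cl_eq_add_of_range_eq (a : X ⟶ P) (b : Y ⟶ P) (c : W ⟶ P) [IsImmersion a]
    [IsImmersion b] [IsImmersion c] [CompactSpace X] [CompactSpace Y] [CompactSpace W]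
    (C : Set P) (hC : IsClosed C) (hb : Set.range b = Set.range a ∩ C)
    (hc : Set.range c = Set.range a \ C) :
    μ.cl X (a ≫ sP) = μ.cl W (c ≫ sP) + μ.cl Y (b ≫ sP) := by
  have hr : Set.range (pullback.fst a b) = a ⁻¹' C := by
    rw [Scheme.Pullback.range_fst, hb]
    simp
  have hcl : IsClosed (a ⁻¹' C) := hC.preimage a.continuous
  have : IsClosedImmersion (pullback.fst a b) :=
    IsImmersion.isClosedImmersion_of_isClosed_range _ (hr ▸ hcl)
  have h1 : CompactSpace ↥(pullback a b) := (pullback.fst a b).isClosedEmbedding.compactSpace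
  let U : X.Opens := ⟨(a ⁻¹' C)ᶜ, hcl.isOpen_compl⟩
  have hU : Set.range (U.ι ≫ a) = Set.range c := by
    rw [Scheme.Hom.comp_base, TopCat.coe_comp, Set.range_comp, Scheme.Opens.range_ι, hc]
    ext y
    simp only [U, Set.mem_image, Set.mem_sdiff, Set.mem_range]
    constructor
    · rintro ⟨x, hx, rfl⟩
      exact ⟨⟨x, rfl⟩, hx⟩
    · rintro ⟨⟨x, rfl⟩, hx⟩
      exact ⟨x, hx, rfl⟩
  have h2 : CompactSpace U.toScheme := by
    rw [← isCompact_univ_iff, (U.ι ≫ a).isEmbedding.isCompact_iff, Set.image_univ, hU]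
    exact isCompact_range c.continuous
  rw [μ.cl_scissor (a ≫ sP) (pullback.fst a b) inferInstance inferInstance inferInstance
    inferInstance U (by rw [hr]; rfl)]
  congr 1
  · simpa using μ.cl_eq_of_range_eq sP (U.ι ≫ a) c hU
  · simpa using μ.cl_eq_of_range_eq sP (pullback.fst a b ≫ a) b (by
      rw [Scheme.Hom.comp_base, TopCat.coe_comp, Set.range_comp]
      erw [hr]
      rw [hb, Set.image_preimage_eq_inter_range, Set.inter_comm])

end Immersion

end MotivicMeasure

end

noncomputable section

attribute [local instance] MvPolynomial.gradedAlgebra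

namespace MotivicMeasure

variable {k : Type u} [Field k] {R : Type v} [CommRing R] (μ : MotivicMeasure k R)

/-- The class of the spectrum of a `k`-algebra under a motivic measure. -/
def clSpec (A : Type u) [CommRing A] [Algebra k A] : R :=
  μ.cl (Spec (CommRingCat.of A)) (Spec.map (CommRingCat.ofHom (algebraMap k A)))

variable (A B : Type u) [CommRing A] [Algebra k A] [CommRing B] [Algebra k B]

theorem _root_.AlgebraicGeometry.Spec.locallyOfFiniteType_map_algebraMap
    [Algebra.FiniteType k A] :
    LocallyOfFiniteType (Spec.map (CommRingCat.ofHom (algebraMap k A))) := by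
  rw [HasRingHomProperty.Spec_iff (P := @LocallyOfFiniteType)]
  exact RingHom.finiteType_algebraMap.mpr inferInstance

variable {A B} in
theorem clSpec_congr [Algebra.FiniteType k A] (e : A ≃ₐ[k] B) : μ.clSpec A = μ.clSpec B := by
  refine μ.cl_iso _ _ (Scheme.Spec.mapIso e.symm.toRingEquiv.toCommRingCatIso.op)
    (Spec.locallyOfFiniteType_map_algebraMap A) inferInstance inferInstance ?_
  simp only [Functor.mapIso_hom, Iso.op_hom, Scheme.Spec_map, Quiver.Hom.unop_op]
  rw [← Spec.map_comp]
  congr 1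
  ext x
  simp

theorem clSpec_self : μ.clSpec k = 1 := by
  rw [← μ.cl_point, clSpec]
  congr 1
  exact Spec.map_id _

theorem clSpec_polynomial [Algebra.FiniteType k A] :
    μ.clSpec (Polynomial A) = μ.clSpec A * μ.lef := by
  rw [μ.clSpec_congr ((polyEquivTensor k A).restrictScalars k)]
  have h := μ.cl_prod (Spec.map (CommRingCat.ofHom (algebraMap k A))) (AffineLine.toSpec k)
    (Spec.locallyOfFiniteType_map_algebraMap A) inferInstance inferInstance
    (Spec.locallyOfFiniteType_map_algebraMap (Polynomial k))
    (inferInstanceAs (QuasiCompact (Spec.map (CommRingCat.ofHom (algebraMap k (Polynomial k))))))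
    (inferInstanceAs (IsSeparated (Spec.map (CommRingCat.ofHom (algebraMap k (Polynomial k))))))
  have : Algebra.FiniteType k (TensorProduct k A (Polynomial k)) :=
    .equiv inferInstance ((polyEquivTensor k A).restrictScalars k)
  rw [clSpec, clSpec, lef, ← h]
  refine μ.cl_iso _ _ (pullbackSpecIso k A (Polynomial k)).symm
    (Spec.locallyOfFiniteType_map_algebraMap _) inferInstance inferInstance ?_
  refine (pullbackSpecIso_inv_fst_assoc k A (Polynomial k) _).trans ?_
  rw [← Spec.map_comp]
  rfl

theorem clSpec_mvPolynomial_fin [Algebra.FiniteType k A] (m : ℕ) :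
    μ.clSpec (MvPolynomial (Fin m) A) = μ.clSpec A * μ.lef ^ m := by
  induction m with
  | zero =>
    rw [← μ.clSpec_congr ((MvPolynomial.isEmptyAlgEquiv A (Fin 0)).restrictScalars k).symm]
    simp
  | succ m ih =>
    rw [μ.clSpec_congr ((MvPolynomial.finSuccEquiv A m).restrictScalars k), clSpec_polynomial, ih]
    ring

theorem clSpec_mvPolynomial [Algebra.FiniteType k A] (σ : Type) [Fintype σ] :
    μ.clSpec (MvPolynomial σ A) = μ.clSpec A * μ.lef ^ Fintype.card σ := by
  rw [μ.clSpec_congr ((MvPolynomial.renameEquiv A (Fintype.equivFin σ)).restrictScalars k),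
    clSpec_mvPolynomial_fin]

end MotivicMeasure

end

noncomputable section

attribute [local instance] MvPolynomial.gradedAlgebra

namespace MvPolynomial

theorem IsHomogeneous.aeval_mul_left {σ S B : Type*} [CommSemiring S] [CommSemiring B]
    [Algebra S B] {g : MvPolynomial σ S} {N : ℕ} (hg : g.IsHomogeneous N) (c : B) (y : σ → B) :
    MvPolynomial.aeval (fun j => c * y j) g = c ^ N * MvPolynomial.aeval y g := by
  simp only [MvPolynomial.aeval_def, eval₂_eq, Finset.mul_sum]
  refine Finset.sum_congr rfl fun v hv => ?_
  have hN : ∑ i ∈ v.support, v i = N := by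
    have := hg (mem_support_iff.mp hv)
    rw [← this, Finsupp.weight_apply, Finsupp.sum]
    simp
  simp only [mul_pow, Finset.prod_mul_distrib, Finset.prod_pow_eq_pow_sum, hN]
  ring

end MvPolynomial

namespace ProjSpace

variable (k : Type u) [Field k] (n : ℕ) (i : Fin (n + 1))

/-- The coordinate ring of the standard chart `D₊(xᵢ)` of projective space. -/
abbrev Chart : Type u :=
  HomogeneousLocalization.Away (homogeneousSubmodule (Fin (n + 1)) k) (X i)

theorem X_mem : (X i : MvPolynomial (Fin (n + 1)) k) ∈ homogeneousSubmodule (Fin (n + 1)) k 1 :=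
  isHomogeneous_X k i

/-- The structure map of the chart `D₊(xᵢ)`. -/
def chartAlgebraMap : k →+* Chart k n i :=
  (HomogeneousLocalization.fromZeroRingHom (homogeneousSubmodule (Fin (n + 1)) k) _).comp
    (algebraMap k (homogeneousSubmodule (Fin (n + 1)) k 0))

theorem val_chartAlgebraMap (c : k) : (chartAlgebraMap k n i c).val =
    algebraMap k (Localization.Away (X i : MvPolynomial (Fin (n + 1)) k)) c := by
  rw [IsScalarTower.algebraMap_apply k (MvPolynomial (Fin (n + 1)) k),
    ← Localization.mk_one_eq_algebraMap]
  rfl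

/-- The inverse of `xᵢ` in the localization of `k[x₀, …, xₙ]` at `xᵢ`. -/
def invX : Localization.Away (X i : MvPolynomial (Fin (n + 1)) k) :=
  IsLocalization.Away.invSelf (X i : MvPolynomial (Fin (n + 1)) k)

variable {k n} in
theorem val_mk_eq_invX_pow_mul {g : MvPolynomial (Fin (n + 1)) k} (N : ℕ)
    (hg : g ∈ homogeneousSubmodule (Fin (n + 1)) k (N • 1)) :
    (HomogeneousLocalization.Away.mk _ (X_mem k n i) N g hg).val =
      invX k n i ^ N * algebraMap (MvPolynomial (Fin (n + 1)) k) _ g := by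
  rw [HomogeneousLocalization.Away.val_mk, Localization.mk_eq_mk', IsLocalization.mk'_eq_iff_eq_mul,
    map_pow, mul_right_comm, ← mul_pow, mul_comm (invX k n i),
    invX, IsLocalization.Away.mul_invSelf, one_pow, one_mul]

/-- Dehomogenization: the map `k[x₀, …, xₙ] → Γ(D₊(xᵢ))` sending `xⱼ` to `xⱼ / xᵢ`. -/
def dehom : MvPolynomial (Fin (n + 1)) k →+* Chart k n i :=
  eval₂Hom (chartAlgebraMap k n i)
    fun j => HomogeneousLocalization.Away.mk _ (X_mem k n i) 1 (X j) (X_mem k n j)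

theorem val_dehom (g : MvPolynomial (Fin (n + 1)) k) : (dehom k n i g).val =
    aeval (fun j => invX k n i * algebraMap (MvPolynomial (Fin (n + 1)) k) _ (X j)) g := by
  have h : (algebraMap (Chart k n i) (Localization.Away (X i : MvPolynomial (Fin (n + 1)) k))).comp
      (dehom k n i) = (aeval (R := k) (fun j => invX k n i *
        algebraMap (MvPolynomial (Fin (n + 1)) k) _ (X j))).toRingHom := by
    apply MvPolynomial.ringHom_ext
    · intro c
      rw [RingHom.comp_apply, dehom, coe_eval₂Hom, eval₂_C, HomogeneousLocalization.algebraMap_apply,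
        val_chartAlgebraMap, AlgHom.toRingHom_eq_coe, RingHom.coe_coe, aeval_C]
    · intro j
      rw [RingHom.comp_apply, dehom, coe_eval₂Hom, eval₂_X, HomogeneousLocalization.algebraMap_apply,
        val_mk_eq_invX_pow_mul, AlgHom.toRingHom_eq_coe, RingHom.coe_coe, aeval_X, pow_one]
  exact RingHom.congr_fun h g

variable {k n} in
theorem dehom_eq_mk {g : MvPolynomial (Fin (n + 1)) k} (N : ℕ)
    (hg : g ∈ homogeneousSubmodule (Fin (n + 1)) k (N • 1)) :
    dehom k n i g = HomogeneousLocalization.Away.mk _ (X_mem k n i) N g hg := by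
  apply HomogeneousLocalization.val_injective
  have hg' : g.IsHomogeneous N := by simpa using hg
  rw [val_dehom, hg'.aeval_mul_left, val_mk_eq_invX_pow_mul]
  congr 1
  exact (aeval_algebraMap_apply _ X g).trans (by rw [aeval_X_left_apply])

theorem dehom_C (c : k) : dehom k n i (C c) = chartAlgebraMap k n i c := by
  rw [dehom, coe_eval₂Hom, eval₂_C]

theorem dehom_surjective : Function.Surjective (dehom k n i) := fun a => by
  obtain ⟨N, g, hg, rfl⟩ := HomogeneousLocalization.Away.mk_surjective _ (X_mem k n i) a
  exact ⟨g, dehom_eq_mk i N hg⟩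

theorem dehom_X_self : dehom k n i (X i) = 1 := by
  apply HomogeneousLocalization.val_injective
  rw [val_dehom, aeval_X, HomogeneousLocalization.val_one, mul_comm, invX,
    IsLocalization.Away.mul_invSelf]

section lift

variable {k n i} {B : Type u} [CommRing B]
  (φ : MvPolynomial (Fin (n + 1)) k →+* B) (hφ : φ (X i) = 1)

/-- The map on the chart `D₊(xᵢ)` induced by a ring map sending `xᵢ` to `1`. -/
def chartLift : Chart k n i →+* B :=
  (IsLocalization.Away.lift (S := Localization.Away (X i : MvPolynomial (Fin (n + 1)) k))
    (X i) (g := φ) (by rw [hφ]; exact isUnit_one)).comp (algebraMap _ _)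

theorem chartLift_dehom (g : MvPolynomial (Fin (n + 1)) k) :
    chartLift φ hφ (dehom k n i g) = φ g := by
  have hu : IsUnit (φ (X i)) := by rw [hφ]; exact isUnit_one
  have key : ∀ x, IsLocalization.Away.lift (S := Localization.Away
      (X i : MvPolynomial (Fin (n + 1)) k)) (X i) hu (algebraMap (MvPolynomial (Fin (n + 1)) k) _ x) = φ x :=
    fun x => IsLocalization.Away.lift_eq (X i) hu x
  have hinv : IsLocalization.Away.lift (X i) hu (invX k n i) = 1 := by
    have h1 := congrArg (IsLocalization.Away.lift (X i) hu)
      (IsLocalization.Away.mul_invSelf (S := Localization.Away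
        (X i : MvPolynomial (Fin (n + 1)) k)) (X i : MvPolynomial (Fin (n + 1)) k))
    rw [map_mul, key, hφ, one_mul, map_one] at h1
    exact h1
  have h : (chartLift φ hφ).comp (dehom k n i) = φ := by
    apply MvPolynomial.ringHom_ext
    · intro c
      rw [RingHom.comp_apply, chartLift, RingHom.comp_apply,
        HomogeneousLocalization.algebraMap_apply, val_dehom, aeval_C,
        IsScalarTower.algebraMap_apply k (MvPolynomial (Fin (n + 1)) k), key]
      rfl
    · intro j
      rw [RingHom.comp_apply, chartLift, RingHom.comp_apply,
        HomogeneousLocalization.algebraMap_apply, val_dehom, aeval_X, map_mul, key, hinv, one_mul]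
  exact RingHom.congr_fun h g

end lift

end ProjSpace

end

noncomputable section

attribute [local instance] MvPolynomial.gradedAlgebra

namespace ProjSpace

variable (k : Type u) [Field k] (n : ℕ)

theorem algebraMap_zero_surjective : Function.Surjective
    (algebraMap k (homogeneousSubmodule (Fin (n + 1)) k 0)) := fun ⟨g, hg⟩ => by
  refine ⟨constantCoeff g, Subtype.ext ?_⟩
  have := totalDegree_eq_zero_iff_eq_C.mp
    (Nat.le_zero.mp (IsHomogeneous.totalDegree_le (mem_homogeneousSubmodule 0 g |>.mp hg)))
  exact this.symm

instance : Algebra.FiniteType (homogeneousSubmodule (Fin (n + 1)) k 0)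
    (MvPolynomial (Fin (n + 1)) k) :=
  RingHom.finiteType_algebraMap.mp <| RingHom.FiniteType.of_comp_finiteType
    (f := algebraMap k (homogeneousSubmodule (Fin (n + 1)) k 0)) <|
    RingHom.finiteType_algebraMap.mpr (inferInstanceAs
      (Algebra.FiniteType k (MvPolynomial (Fin (n + 1)) k)))

instance : LocallyOfFiniteType (toSpec k n) := by
  have : LocallyOfFiniteType (Spec.map (CommRingCat.ofHom
      (algebraMap k (homogeneousSubmodule (Fin (n + 1)) k 0)))) := by
    rw [HasRingHomProperty.Spec_iff (P := @LocallyOfFiniteType)]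
    exact RingHom.FiniteType.of_surjective _ (algebraMap_zero_surjective k n)
  exact inferInstanceAs (LocallyOfFiniteType
    (Proj.toSpecZero (homogeneousSubmodule (Fin (n + 1)) k) ≫ Spec.map (CommRingCat.ofHom
      (algebraMap k (homogeneousSubmodule (Fin (n + 1)) k 0)))))

instance : IsSeparated (toSpec k n) :=
  inferInstanceAs (IsSeparated
    (Proj.toSpecZero (homogeneousSubmodule (Fin (n + 1)) k) ≫ Spec.map (CommRingCat.ofHom
      (algebraMap k (homogeneousSubmodule (Fin (n + 1)) k 0)))))

section zeroSet

variable {k n}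

/-- The zero locus in projective space of a set of polynomials. -/
def zeroSet (S : Set (MvPolynomial (Fin (n + 1)) k)) : Set (ProjSpace k n) :=
  ProjectiveSpectrum.zeroLocus (homogeneousSubmodule (Fin (n + 1)) k) S

theorem isClosed_zeroSet (S : Set (MvPolynomial (Fin (n + 1)) k)) : IsClosed (zeroSet S) :=
  ProjectiveSpectrum.isClosed_zeroLocus _ S

theorem zeroSet_union (S T : Set (MvPolynomial (Fin (n + 1)) k)) :
    zeroSet (S ∪ T) = zeroSet S ∩ zeroSet T :=
  ProjectiveSpectrum.zeroLocus_union _ S T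

theorem zeroSet_anti_mono {S T : Set (MvPolynomial (Fin (n + 1)) k)} (h : S ⊆ T) :
    zeroSet T ⊆ zeroSet S :=
  ProjectiveSpectrum.zeroLocus_anti_mono _ h

end zeroSet

section chart

variable {k n} (i : Fin (n + 1))

/-- The inclusion of the standard chart `D₊(xᵢ)`. -/
def chartι : Spec (CommRingCat.of (Chart k n i)) ⟶ ProjSpace k n :=
  Proj.awayι (homogeneousSubmodule (Fin (n + 1)) k) (X i) (X_mem k n i) one_pos

instance : IsOpenImmersion (chartι (k := k) i) :=
  inferInstanceAs (IsOpenImmersion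
    (Proj.awayι (homogeneousSubmodule (Fin (n + 1)) k) (X i) (X_mem k n i) one_pos))

theorem chartι_toSpec : chartι (k := k) i ≫ toSpec k n =
    Spec.map (CommRingCat.ofHom (chartAlgebraMap k n i)) := by
  refine (Proj.awayι_toSpecZero_assoc (homogeneousSubmodule (Fin (n + 1)) k) (X i)
    (X_mem k n i) one_pos _).trans ?_
  rw [← Spec.map_comp]
  rfl

theorem mem_chartι_iff {g : MvPolynomial (Fin (n + 1)) k} {N : ℕ} (hN : 0 < N)
    (hg : g.IsHomogeneous N) (q : Spec (CommRingCat.of (Chart k n i))) :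
    g ∈ (show ProjectiveSpectrum _ from chartι i q).asHomogeneousIdeal ↔
      dehom k n i g ∈ (show PrimeSpectrum (Chart k n i) from q).asIdeal := by
  have h := Proj.awayι_preimage_basicOpen (homogeneousSubmodule (Fin (n + 1)) k)
    (X_mem k n i) one_pos (g := g) hg hN
  have h' := congrArg (fun U => q ∈ U) h
  have e : HomogeneousLocalization.Away.isLocalizationElem (X_mem k n i)
      (show g ∈ homogeneousSubmodule (Fin (n + 1)) k N from hg) = dehom k n i g := by
    rw [dehom_eq_mk i N (by simpa using hg)]
    simp [HomogeneousLocalization.Away.isLocalizationElem]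
  rw [e] at h'
  exact not_iff_not.mp (iff_of_eq h')

theorem range_chartι : Set.range (chartι (k := k) i) = (zeroSet {X i})ᶜ := by
  have h := Proj.opensRange_awayι (homogeneousSubmodule (Fin (n + 1)) k) (X i)
    (X_mem k n i) one_pos
  exact (congrArg (fun U : (Proj (homogeneousSubmodule (Fin (n + 1)) k)).Opens => U.1) h).trans
    (ProjectiveSpectrum.basicOpen_eq_zeroLocus_compl _ _)

variable {B : Type u} [CommRing B]
  (φ : MvPolynomial (Fin (n + 1)) k →+* B) (hφ : φ (X i) = 1)

/-- The morphism to projective space induced by a ring map sending `xᵢ` to `1`. -/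
def chartMap : Spec (CommRingCat.of B) ⟶ ProjSpace k n :=
  Spec.map (CommRingCat.ofHom (chartLift φ hφ)) ≫ chartι i

theorem chartMap_toSpec : chartMap i φ hφ ≫ toSpec k n =
    Spec.map (CommRingCat.ofHom (φ.comp C)) := by
  rw [chartMap, Category.assoc, chartι_toSpec, ← Spec.map_comp, ← CommRingCat.ofHom_comp]
  congr 2
  ext c
  rw [RingHom.comp_apply, ← dehom_C, chartLift_dehom, RingHom.comp_apply]

theorem isImmersion_chartMap (hs : Function.Surjective φ) : IsImmersion (chartMap i φ hφ) := by
  have : IsClosedImmersion (Spec.map (CommRingCat.ofHom (chartLift φ hφ))) :=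
    IsClosedImmersion.spec_of_surjective _ fun b => by
      obtain ⟨a, rfl⟩ := hs b
      exact ⟨_, chartLift_dehom φ hφ a⟩
  unfold chartMap
  infer_instance

end chart

section stratum

variable {k n} (i : Fin (n + 1)) (S : Set (MvPolynomial (Fin (n + 1)) k))

/-- The coordinate ring of the part of `V(S)` lying in the chart `D₊(xᵢ)`. -/
abbrev ChartQuotient : Type u :=
  MvPolynomial (Fin (n + 1)) k ⧸ Ideal.span (insert (X i - 1) S)

theorem chartQuotient_mk_X : Ideal.Quotient.mk (Ideal.span (insert (X i - 1) S)) (X i) = 1 := by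
  rw [← map_one (Ideal.Quotient.mk _), Ideal.Quotient.eq]
  exact Ideal.subset_span (Set.mem_insert _ _)

/-- The inclusion of the part of `V(S)` lying in the chart `D₊(xᵢ)`. -/
def chartQuotientι : Spec (CommRingCat.of (ChartQuotient i S)) ⟶ ProjSpace k n :=
  chartMap i (Ideal.Quotient.mk _) (chartQuotient_mk_X i S)

instance : IsImmersion (chartQuotientι i S) :=
  isImmersion_chartMap _ _ _ Ideal.Quotient.mk_surjective

theorem chartQuotientι_toSpec : chartQuotientι i S ≫ toSpec k n =
    Spec.map (CommRingCat.ofHom (algebraMap k (ChartQuotient i S))) :=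
  chartMap_toSpec _ _ _

theorem range_chartQuotientι (hS : ∀ g ∈ S, ∃ N, 0 < N ∧ g.IsHomogeneous N) :
    Set.range (chartQuotientι i S) = zeroSet S \ zeroSet {X i} := by
  have hrange : Set.range (chartQuotientι i S) = chartι i ''
      Set.range (Spec.map (CommRingCat.ofHom (chartLift _ (chartQuotient_mk_X i S)))) := by
    rw [← Set.range_comp, chartQuotientι, chartMap, Scheme.Hom.comp_base]
    rfl
  have hker : Set.range (Spec.map (CommRingCat.ofHom (chartLift _ (chartQuotient_mk_X i S)))) =
      {q | ∀ g ∈ S, dehom k n i g ∈ (show PrimeSpectrum (Chart k n i) from q).asIdeal} := by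
    have hsurj : Function.Surjective (chartLift _ (chartQuotient_mk_X i S)) := fun b => by
      obtain ⟨a, rfl⟩ := Ideal.Quotient.mk_surjective b
      exact ⟨_, chartLift_dehom _ _ a⟩
    refine (range_comap_of_surjective _ _ hsurj).trans ?_
    ext q
    constructor
    · intro hq g hg
      refine hq ?_
      rw [SetLike.mem_coe, RingHom.mem_ker, chartLift_dehom, Ideal.Quotient.eq_zero_iff_mem]
      exact Ideal.subset_span (Set.mem_insert_of_mem _ hg)
    · intro hq a ha
      obtain ⟨a, rfl⟩ := dehom_surjective k n i a
      rw [SetLike.mem_coe, RingHom.mem_ker, chartLift_dehom, Ideal.Quotient.eq_zero_iff_mem] at ha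
      have : Ideal.span (insert (X i - 1) S) ≤ q.asIdeal.comap (dehom k n i) := by
        rw [Ideal.span_le, Set.insert_subset_iff]
        refine ⟨?_, hq⟩
        rw [SetLike.mem_coe, Ideal.mem_comap, map_sub, map_one, dehom_X_self, sub_self]
        exact q.asIdeal.zero_mem
      exact this ha
  rw [hrange, hker, Set.sdiff_eq, ← range_chartι]
  ext x
  constructor
  · rintro ⟨q, hq, rfl⟩
    refine ⟨fun g hg => ?_, q, rfl⟩
    obtain ⟨N, hN, hgN⟩ := hS g hg
    exact (mem_chartι_iff i hN hgN q).mpr (hq g hg)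
  · rintro ⟨hx, q, rfl⟩
    refine ⟨q, fun g hg => ?_, rfl⟩
    obtain ⟨N, hN, hgN⟩ := hS g hg
    exact (mem_chartι_iff i hN hgN q).mp (hx hg)

end stratum

end ProjSpace

end

noncomputable section

attribute [local instance] MvPolynomial.gradedAlgebra

theorem AlgebraicGeometry.Scheme.exists_isClosedImmersion_range_eq (P : Scheme.{u}) {C : Set P}
    (hC : IsClosed C) :
    ∃ (Y : Scheme.{u}) (i : Y ⟶ P), IsClosedImmersion i ∧ Set.range i = C :=
  ⟨_, (Scheme.IdealSheafData.vanishingIdeal ⟨C, hC⟩).subschemeι, inferInstance, by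
    rw [Scheme.IdealSheafData.range_subschemeι, Scheme.IdealSheafData.coe_support_vanishingIdeal]
    rfl⟩

namespace ProjSpace

variable {k : Type u} [Field k] {n : ℕ}

instance : CompactSpace (ProjSpace k n) := by
  have : CompactSpace (Proj (homogeneousSubmodule (Fin (n + 1)) k)) :=
    QuasiCompact.compactSpace_of_compactSpace
      (Proj.toSpecZero (homogeneousSubmodule (Fin (n + 1)) k))
  exact this

theorem zeroSet_range_X : zeroSet (Set.range (X : Fin (n + 1) → MvPolynomial _ k)) = ∅ := by
  refine Set.eq_empty_of_forall_notMem fun x hx => x.not_irrelevant_le fun g hg => ?_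
  have h0 : coeff 0 g = 0 := by
    have h : homogeneousComponent 0 g = 0 := by
      rw [← hg]
      exact (decomposition.decompose'_apply g 0).symm
    simpa using congrArg (coeff 0) h
  refine (Ideal.span_le.mpr hx : Ideal.span _ ≤ x.asHomogeneousIdeal.toIdeal) ?_
  rw [← Set.image_univ, mem_ideal_span_X_image]
  intro m hm
  by_contra! hm0
  refine mem_support_iff.mp hm ?_
  rwa [show m = 0 from Finsupp.ext fun i => by simpa using hm0 i]

end ProjSpace

namespace MotivicMeasure

variable {k : Type u} [Field k] {R : Type v} [CommRing R] (μ : MotivicMeasure k R) {n : ℕ}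

open ProjSpace

/-- The decomposition of a closed subvariety of projective space according to the first
non-vanishing homogeneous coordinate. -/
theorem cl_eq_sum_clSpec {S : Set (MvPolynomial (Fin (n + 1)) k)}
    (hS : ∀ g ∈ S, ∃ N, 0 < N ∧ g.IsHomogeneous N) {Y : Scheme.{u}} (a : Y ⟶ ProjSpace k n)
    [IsClosedImmersion a] (ha : Set.range a = zeroSet S) :
    μ.cl Y (a ≫ toSpec k n) =
      ∑ i : Fin (n + 1), μ.clSpec (ChartQuotient i (S ∪ X '' {j | j < i})) := by
  let T (m : ℕ) : Set (MvPolynomial (Fin (n + 1)) k) := S ∪ X '' {j | (j : ℕ) < m}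
  have hT (m : ℕ) : ∀ g ∈ T m, ∃ N, 0 < N ∧ g.IsHomogeneous N := by
    rintro g (hg | ⟨j, -, rfl⟩)
    · exact hS g hg
    · exact ⟨1, one_pos, isHomogeneous_X k j⟩
  choose V v hv hvr using fun m : ℕ => (ProjSpace k n).exists_isClosedImmersion_range_eq
    (isClosed_zeroSet (T m))
  have hcompact {Y : Scheme.{u}} (a : Y ⟶ ProjSpace k n) [IsClosedImmersion a] : CompactSpace Y :=
    QuasiCompact.compactSpace_of_compactSpace a
  have (m : ℕ) : CompactSpace (V m) := hcompact (v m)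
  have : CompactSpace Y := hcompact a
  let c (m : ℕ) : R := μ.cl (V m) (v m ≫ toSpec k n)
  have h0 : μ.cl Y (a ≫ toSpec k n) = c 0 := by
    refine μ.cl_eq_of_range_eq _ _ _ ?_
    rw [ha, hvr]
    congr 1
    simp [T]
  have hlast : c (n + 1) = 0 := by
    have : IsEmpty (V (n + 1)) := by
      rw [← Set.range_eq_empty_iff (f := v (n + 1)), hvr, ← Set.subset_empty_iff,
        ← zeroSet_range_X]
      refine zeroSet_anti_mono ?_
      rintro _ ⟨j, rfl⟩
      exact Or.inr ⟨j, j.2, rfl⟩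
    exact μ.cl_eq_zero_of_isEmpty _
  have hstep (i : Fin (n + 1)) :
      μ.clSpec (ChartQuotient i (S ∪ X '' {j | j < i})) = c i - c (i + 1) := by
    have : CompactSpace (Spec (CommRingCat.of (ChartQuotient i (T i)))) :=
      inferInstanceAs (CompactSpace (PrimeSpectrum (ChartQuotient i (T i))))
    have h := μ.cl_eq_add_of_range_eq (toSpec k n) (v i) (v (i + 1))
      (chartQuotientι i (T i)) (zeroSet {X i})
      (isClosed_zeroSet _)
      (by
        rw [hvr, hvr, ← zeroSet_union]
        congr 1
        simp only [T, Set.union_assoc]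
        congr 1
        rw [← Set.image_singleton, ← Set.image_union]
        congr 1
        ext j
        simp only [Set.mem_ofPred_eq, Set.mem_union, Set.mem_singleton_iff, Fin.ext_iff]
        omega)
      (by rw [hvr, range_chartQuotientι _ _ (hT _)])
    rw [chartQuotientι_toSpec] at h
    exact eq_sub_of_add_eq h.symm
  rw [h0, Finset.sum_congr rfl fun i _ => hstep i,
    Fin.sum_univ_eq_sum_range (fun m => c m - c (m + 1)), Finset.sum_range_sub', hlast, sub_zero]

end MotivicMeasure

end

noncomputable section

namespace Fin

/-- The splitting of `Fin (n + 1)` into its first `s + 1` and its last `n - s` elements. -/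
def sumEquivOfLE {s n : ℕ} (h : s ≤ n) : Fin (s + 1) ⊕ Fin (n - s) ≃ Fin (n + 1) :=
  finSumFinEquiv.trans (finCongr (by omega))

variable {s n : ℕ} (h : s ≤ n)

theorem sumEquivOfLE_inl (j : Fin (s + 1)) :
    sumEquivOfLE h (Sum.inl j) = castLE (by omega) j := rfl

theorem val_sumEquivOfLE_inr (j : Fin (n - s)) :
    (sumEquivOfLE h (Sum.inr j) : ℕ) = s + 1 + j := rfl

end Fin

namespace MotivicMeasure

variable {k : Type u} [Field k] {R : Type v} [CommRing R] (μ : MotivicMeasure k R) {n s : ℕ}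

open ProjSpace

theorem clSpec_quotient_congr {A : Type u} [CommRing A] [Algebra k A] {I J : Ideal A}
    (h : I = J) : μ.clSpec (A ⧸ I) = μ.clSpec (A ⧸ J) := by
  rw [h]

theorem clSpec_quotient_map_rename (h : s ≤ n) (I : Ideal (MvPolynomial (Fin (s + 1)) k)) :
    μ.clSpec (MvPolynomial (Fin (n + 1)) k ⧸ I.map (rename (R := k)
      (Fin.castLE (Nat.succ_le_succ h)))) =
      μ.clSpec (MvPolynomial (Fin (s + 1)) k ⧸ I) * μ.lef ^ (n - s) := by
  let e : MvPolynomial (Fin (n + 1)) k ≃ₐ[k]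
      MvPolynomial (Fin (n - s)) (MvPolynomial (Fin (s + 1)) k) :=
    (renameEquiv k ((Fin.sumEquivOfLE h).symm.trans (Equiv.sumComm _ _))).trans
      (sumAlgEquiv k _ _)
  have he (g : MvPolynomial (Fin (s + 1)) k) :
      e (rename (Fin.castLE (Nat.succ_le_succ h)) g) = C g := by
    have : (e.toAlgHom.comp (rename (Fin.castLE (Nat.succ_le_succ h)))) =
        (Algebra.ofId _ (MvPolynomial (Fin (n - s)) (MvPolynomial (Fin (s + 1)) k))).restrictScalars
          k := by
      ext j : 1
      have hj : (Fin.sumEquivOfLE h).symm (Fin.castLE (Nat.succ_le_succ h) j) = Sum.inl j := by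
        rw [Equiv.symm_apply_eq, Fin.sumEquivOfLE_inl]
      simp [e, hj]
    exact DFunLike.congr_fun this g
  have hI : I.map (C (σ := Fin (n - s))) =
      (I.map (rename (R := k) (Fin.castLE (Nat.succ_le_succ h)))).map (e : _ →+* _) := by
    refine le_antisymm (Ideal.map_le_iff_le_comap.mpr fun g hg => ?_)
      (Ideal.map_le_iff_le_comap.mpr <| Ideal.map_le_iff_le_comap.mpr fun g hg => ?_)
    · rw [Ideal.mem_comap, ← he]
      exact Ideal.mem_map_of_mem _ (Ideal.mem_map_of_mem _ hg)
    · rw [Ideal.mem_comap, Ideal.mem_comap]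
      exact (he g).symm ▸ Ideal.mem_map_of_mem C hg
  let E : (MvPolynomial (Fin (n + 1)) k ⧸ I.map (rename (R := k)
      (Fin.castLE (Nat.succ_le_succ h)))) ≃ₐ[k]
      MvPolynomial (Fin (n - s)) (MvPolynomial (Fin (s + 1)) k) ⧸ I.map C :=
    Ideal.quotientEquivAlg _ _ e hI
  rw [← clSpec_mvPolynomial_fin]
  have h2 := μ.clSpec_congr (A := MvPolynomial (Fin (n - s)) (MvPolynomial (Fin (s + 1)) k ⧸ I))
    (B := MvPolynomial (Fin (n - s)) (MvPolynomial (Fin (s + 1)) k) ⧸ I.map C)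
    ((quotientEquivQuotientMvPolynomial (σ := Fin (n - s)) I).restrictScalars k)
  exact (μ.clSpec_congr (B := MvPolynomial (Fin (n - s)) (MvPolynomial (Fin (s + 1)) k) ⧸
    I.map C) E).trans h2.symm

theorem clSpec_chartQuotient_castLE (h : s ≤ n) (S : Set (MvPolynomial (Fin (s + 1)) k))
    (i : Fin (s + 1)) :
    μ.clSpec (ChartQuotient (Fin.castLE (Nat.succ_le_succ h) i)
      (rename (Fin.castLE (Nat.succ_le_succ h)) '' S ∪
        X '' {j | j < Fin.castLE (Nat.succ_le_succ h) i})) =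
      μ.clSpec (ChartQuotient i (S ∪ X '' {j | j < i})) * μ.lef ^ (n - s) := by
  rw [← clSpec_quotient_map_rename μ h, Ideal.map_span]
  have : insert (X (Fin.castLE (Nat.succ_le_succ h) i) - 1)
      (rename (R := k) (Fin.castLE (Nat.succ_le_succ h)) '' S ∪
        X '' {j | j < Fin.castLE (Nat.succ_le_succ h) i}) =
      rename (R := k) (Fin.castLE (Nat.succ_le_succ h)) ''
        (insert (X i - 1) (S ∪ X '' {j | j < i})) := by
    rw [Set.image_insert_eq, Set.image_union, Set.image_image, map_sub, map_one, rename_X]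
    congr 2
    ext g
    simp only [Set.mem_image, rename_X]
    constructor
    · rintro ⟨j, hj, rfl⟩
      exact ⟨⟨j, lt_trans hj i.2⟩, hj, rfl⟩
    · rintro ⟨j, hj, rfl⟩
      exact ⟨_, hj, rfl⟩
  exact μ.clSpec_quotient_congr (congrArg Ideal.span this)

theorem clSpec_chartQuotient_of_subset (S : Set (MvPolynomial (Fin (n + 1)) k))
    (i : Fin (n + 1)) (hS : ∀ g ∈ S, g ∈ Ideal.span (X '' {j | j < i})) :
    μ.clSpec (ChartQuotient i (S ∪ X '' {j | j < i})) = μ.lef ^ (n - i) := by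
  have hX (j : Fin (n + 1)) (hj : j < i) :
      Ideal.Quotient.mk (Ideal.span (insert (X i - 1) (S ∪ X '' {j | j < i}))) (X j) = 0 :=
    Ideal.Quotient.eq_zero_iff_mem.mpr
      (Ideal.subset_span (Set.mem_insert_of_mem _ (Or.inr ⟨j, hj, rfl⟩)))
  let φ : MvPolynomial (Fin (n + 1)) k →ₐ[k] MvPolynomial {j // i < j} k :=
    aeval fun j => if hj : i < j then X ⟨j, hj⟩ else if j = i then 1 else 0
  have hφX (j : Fin (n + 1)) (hj : j < i) : φ (X j) = 0 := by
    simp [φ, hj.not_gt, hj.ne]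
  have hφ : ∀ a ∈ Ideal.span (insert (X i - 1) (S ∪ X '' {j | j < i})), φ a = 0 := by
    have h1 : Ideal.span (X '' {j | j < i}) ≤ RingHom.ker φ := by
      rw [Ideal.span_le]
      rintro _ ⟨j, hj, rfl⟩
      exact hφX j hj
    change Ideal.span _ ≤ RingHom.ker φ
    rw [Ideal.span_le]
    rintro g (rfl | hg | ⟨j, hj, rfl⟩)
    · simp [RingHom.mem_ker, φ]
    · exact h1 (hS g hg)
    · exact hφX j hj
  let e : ChartQuotient i (S ∪ X '' {j | j < i}) ≃ₐ[k] MvPolynomial {j // i < j} k :=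
    AlgEquiv.ofAlgHom (Ideal.Quotient.liftₐ _ φ hφ)
      (aeval fun j => Ideal.Quotient.mk _ (X j.1))
      (by
        refine MvPolynomial.algHom_ext fun j => ?_
        rw [AlgHom.comp_apply, aeval_X]
        exact (aeval_X _ _).trans (dif_pos j.2))
      (by
        refine Ideal.Quotient.algHom_ext _ (MvPolynomial.algHom_ext fun j => ?_)
        change aeval _ (φ (X j)) = Ideal.Quotient.mk _ (X j)
        rcases lt_trichotomy j i with hj | rfl | hj
        · rw [hX j hj]
          simp [hφX j hj]
        · rw [chartQuotient_mk_X]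
          simp [φ]
        · simp [φ, hj])
  rw [μ.clSpec_congr e, clSpec_mvPolynomial, clSpec_self, one_mul, Fintype.card_subtype]
  congr 1
  simp [Finset.filter_lt_eq_Ioi]

theorem sum_clSpec_chartQuotient_rename (h : s ≤ n) {f : MvPolynomial (Fin (s + 1)) k} {d : ℕ}
    (hd : 0 < d) (hf : f.IsHomogeneous d) :
    ∑ i : Fin (n + 1), μ.clSpec (ChartQuotient i
        ({rename (Fin.castLE (Nat.succ_le_succ h)) f} ∪ X '' {j | j < i})) =
      ∑ i ∈ Finset.range (n - s), μ.lef ^ i + μ.lef ^ (n - s) *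
        ∑ i : Fin (s + 1), μ.clSpec (ChartQuotient i ({f} ∪ X '' {j | j < i})) := by
  rw [← (Fin.sumEquivOfLE h).sum_comp, Fintype.sum_sum_type, add_comm, Finset.mul_sum]
  congr 1
  · rw [← Finset.sum_range_reflect, ← Fin.sum_univ_eq_sum_range
      (fun i => μ.lef ^ (n - s - 1 - i))]
    refine Finset.sum_congr rfl fun i _ => ?_
    rw [clSpec_chartQuotient_of_subset, Fin.val_sumEquivOfLE_inr]
    · congr 1
      omega
    · rintro _ rfl
      rw [mem_ideal_span_X_image]
      intro m hm
      obtain ⟨u, rfl, hu⟩ := coeff_rename_ne_zero _ _ _ (mem_support_iff.mp hm)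
      obtain ⟨j, hj⟩ : ∃ j, u j ≠ 0 := by
        by_contra! hu0
        obtain rfl : u = 0 := Finsupp.ext hu0
        exact hd.ne ((hf hu).symm.trans (by simp)).symm
      refine ⟨Fin.castLE (Nat.succ_le_succ h) j, ?_, ?_⟩
      · rw [Set.mem_ofPred_eq, Fin.lt_def, Fin.val_sumEquivOfLE_inr, Fin.val_castLE]
        omega
      · rwa [Finsupp.mapDomain_apply (Fin.castLE_injective _)]
  · refine Finset.sum_congr rfl fun i _ => ?_
    rw [mul_comm, ← clSpec_chartQuotient_castLE μ h, Set.image_singleton]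
    rfl

end MotivicMeasure

end

/-- Let `k` be any field, `h₁, …, h_d` homogeneous polynomials of degree 1
with `d ≤ n`, `X := V(h₁ ⋯ h_d) ⊂ ℙⁿ_k`, and let `Y := ⋂ᵢ V(hᵢ)` be the linear subspace of
codimension `r ≤ d` (i.e. the span of the linear forms `hᵢ` has dimension `r`; here we write
`r = s + 1`, noting `r ≥ 1`).  After a linear change of coordinates
`f := h₁ ⋯ h_d ∈ k[x₀, …, x_{r-1}]`, and with `Z := V(f) ⊂ ℙ^{r-1}_k`, one has
`[X] = 1 + 𝕃 + ⋯ + 𝕃^{n-r} + 𝕃^{n-r+1}·[Z]` in `K₀(Var_k)`. -/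
theorem union_of_hyperplanes_class_formula (k : Type u) [Field k] (n d s : ℕ)
    (hd : 1 ≤ d) (hdn : d ≤ n)
    (h : Fin d → MvPolynomial (Fin (n + 1)) k)
    (hh : ∀ i, (h i).IsHomogeneous 1) (hh0 : ∀ i, h i ≠ 0)
    -- `Y = ⋂ᵢ V(hᵢ)` has codimension `r = s + 1 ≤ d` in `ℙⁿ_k`
    (hcodim : Module.finrank k ↥(Submodule.span k (Set.range h)) = s + 1)
    (hrd : s + 1 ≤ d)
    -- after a linear change of coordinates, `f = h₁ ⋯ h_d` lies in `k[x₀, …, x_{r-1}]`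
    (f : MvPolynomial (Fin (s + 1)) k)
    (hf : rename (Fin.castLE (by omega)) f = ∏ i, h i)
    (X : Scheme.{u}) (sX : X ⟶ SpecBase k)
    (hX : IsProjSubvariety k n {∏ i, h i} X sX)
    (Z : Scheme.{u}) (sZ : Z ⟶ SpecBase k)
    (hZ : IsProjSubvariety k s {f} Z sZ) :
    ∀ (R : Type u) [CommRing R] (μ : MotivicMeasure k R),
      μ.cl X sX = (∑ i ∈ Finset.range (n - s), μ.lef ^ i) + μ.lef ^ (n - s) * μ.cl Z sZ := by
  intro R _ μ
  have hd0 : ∑ _i : Fin d, 1 ≠ 0 := by simp; omega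
  have hprod : (∏ i, h i).IsHomogeneous (∑ _i : Fin d, 1) :=
    MvPolynomial.IsHomogeneous.prod _ _ _ fun i _ => hh i
  have hfhom : f.IsHomogeneous (∑ _i : Fin d, 1) := by
    rwa [← hf, IsHomogeneous.rename_isHomogeneous_iff (Fin.castLE_injective _)] at hprod
  obtain ⟨-, a, ha, rfl, hra⟩ := hX
  obtain ⟨-, b, hb, rfl, hrb⟩ := hZ
  rw [μ.cl_eq_sum_clSpec (S := {∏ i, h i}) _ a hra, μ.cl_eq_sum_clSpec (S := {f}) _ b hrb, ← hf]
  · exact μ.sum_clSpec_chartQuotient_rename (by omega) (Nat.pos_of_ne_zero hd0) hfhom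
  · rintro _ rfl
    exact ⟨_, Nat.pos_of_ne_zero hd0, hfhom⟩
  · rintro _ rfl
    exact ⟨_, Nat.pos_of_ne_zero hd0, hprod⟩
end

section
/- Let k be a field, L a finite Galois extension of k, and let f ∈ k[x₀,…,xₙ] be a nonzero homogeneous polynomial of degree d ≤ n which factors over L as a product f = h₁⋯h_d of homogeneous polynomials h₁,…,h_d ∈ L[x₀,…,xₙ] of degree 1. Then f has a nontrivial zero over k, i.e. there exists a nonzero vector a ∈ k^{n+1} with f(a) = 0. -/
open MvPolynomial in
theorem MvPolynomial.IsHomogeneous.eq_sum_C_coeff_mul_X {σ R : Type*} [Fintype σ] [CommSemiring R]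
    {p : MvPolynomial σ R} (hp : p.IsHomogeneous 1) :
    p = ∑ i, C (p.coeff (Finsupp.single i 1)) * X i := by
  classical
  have hmem : p ∈ Submodule.span R (Set.range (X : σ → MvPolynomial σ R)) := by
    rwa [← homogeneousSubmodule_one_eq_span_X, mem_homogeneousSubmodule]
  obtain ⟨c, rfl⟩ := (Submodule.mem_span_range_iff_exists_fun R).mp hmem
  refine Finset.sum_congr rfl fun i _ => ?_
  rw [smul_eq_C_mul]
  congr 2
  simp [coeff_sum, coeff_X, Finsupp.single_left_inj]

open MvPolynomial in
theorem MvPolynomial.IsHomogeneous.irreducible_of_one {σ K : Type*} [Field K]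
    {p : MvPolynomial σ K} (hp : p.IsHomogeneous 1) (hp0 : p ≠ 0) : Irreducible p := by
  refine irreducible_of_totalDegree_eq_one (hp.totalDegree hp0) fun x hx => ?_
  obtain ⟨m, hm⟩ := ne_zero_iff.mp hp0
  exact isUnit_iff_ne_zero.mpr fun h0 => hm (zero_dvd_iff.mp (h0 ▸ hx m))

open MvPolynomial in
/-- Associated polynomials over a field that share a coefficient equal to `1` are equal. -/
theorem MvPolynomial.eq_of_associated_of_coeff_eq_one {σ K : Type*} [Field K]
    {p q : MvPolynomial σ K} (hpq : Associated p q) {m : σ →₀ ℕ}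
    (hp : p.coeff m = 1) (hq : q.coeff m = 1) : p = q := by
  obtain ⟨u, rfl⟩ := hpq
  obtain ⟨r, -, hr⟩ := isUnit_iff_eq_C_of_isReduced.mp u.isUnit
  rw [hr, mul_comm, coeff_C_mul, hp, mul_one] at hq
  rw [hr, hq, C_1, mul_one]

open MvPolynomial in
theorem MvPolynomial.smul_eq_map_algEquiv {σ k L : Type*} [Field k] [Field L] [Algebra k L]
    (s : L ≃ₐ[k] L) (p : MvPolynomial σ L) : s • p = map (s : L →+* L) p := by
  ext m
  rw [coeff_smul, coeff_map]
  rfl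

open MvPolynomial in
/-- A normalized linear factor of a product of `d` linear forms defined over `k` has at most `d`
Galois conjugates. -/
theorem MvPolynomial.card_orbit_le_of_dvd_prod {σ k L : Type*} [Field k] [Field L] [Algebra k L]
    {d : ℕ} {f : MvPolynomial σ k} {h : Fin d → MvPolynomial σ L}
    (hh : ∀ i, (h i).IsHomogeneous 1) (h0 : ∀ i, h i ≠ 0)
    (hsplit : map (algebraMap k L) f = ∏ i, h i)
    {g : MvPolynomial σ L} (hg : g.IsHomogeneous 1) {m : σ →₀ ℕ} (hm : g.coeff m = 1)
    (hdvd : g ∣ ∏ i, h i) :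
    (MulAction.orbit (L ≃ₐ[k] L) g).ncard ≤ d := by
  have hcoeff (s : L ≃ₐ[k] L) : (s • g).coeff m = 1 := by
    rw [smul_eq_map_algEquiv, coeff_map, hm, map_one]
  have hassoc (p : MulAction.orbit (L ≃ₐ[k] L) g) : ∃ j, Associated p.1 (h j) := by
    obtain ⟨_, s, rfl⟩ := p
    have hne : s • g ≠ 0 := ne_zero_iff.mpr ⟨m, by simp [hcoeff]⟩
    have hirr : Irreducible (s • g) := by
      refine IsHomogeneous.irreducible_of_one ?_ hne
      rw [smul_eq_map_algEquiv]
      exact hg.map _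
    have hfix : map (s : L →+* L) (∏ i, h i) = ∏ i, h i := by
      rw [← hsplit, map_map]
      congr 2
      ext x
      exact s.commutes x
    have hsdvd : s • g ∣ ∏ i, h i := by
      rw [smul_eq_map_algEquiv, ← hfix]
      exact map_dvd _ hdvd
    obtain ⟨j, -, hj⟩ := hirr.prime.exists_mem_finset_dvd hsdvd
    exact ⟨j, hirr.associated_of_dvd ((hh j).irreducible_of_one (h0 j)) hj⟩
  choose φ hφ using hassoc
  have hinj : Function.Injective φ := by
    intro p q hpq
    have hpq' : Associated p.1 q.1 := (hφ p).trans (hpq ▸ (hφ q).symm)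
    obtain ⟨_, s, rfl⟩ := p
    obtain ⟨_, t, rfl⟩ := q
    exact Subtype.ext (eq_of_associated_of_coeff_eq_one hpq' (hcoeff s) (hcoeff t))
  simpa using Nat.card_le_card_of_injective φ hinj

open MvPolynomial in
/-- A linear form over `L` with fewer Galois conjugates over `k` than variables has a nontrivial
zero over `k`. -/
theorem MvPolynomial.IsHomogeneous.exists_zero_of_card_orbit_lt {σ k L : Type*} [Fintype σ]
    [Field k] [Field L] [Algebra k L] [FiniteDimensional k L] [IsGalois k L]
    {g : MvPolynomial σ L} (hg : g.IsHomogeneous 1)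
    (hcard : (MulAction.orbit (L ≃ₐ[k] L) g).ncard < Fintype.card σ) :
    ∃ a : σ → k, a ≠ 0 ∧ eval (fun i => algebraMap k L (a i)) g = 0 := by
  let H := MulAction.stabilizer (L ≃ₐ[k] L) g
  let K := IntermediateField.fixedField H
  have hmem (i : σ) : g.coeff (Finsupp.single i 1) ∈ K := by
    rintro ⟨s, hs⟩
    have := congrArg (coeff (Finsupp.single i 1)) (MulAction.mem_stabilizer_iff.mp hs)
    rwa [coeff_smul] at this
  have hfin : Module.finrank k K < Module.finrank k (σ → k) := by
    rw [IntermediateField.finrank_eq_fixingSubgroup_index,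
      IntermediateField.fixingSubgroup_fixedField, MulAction.index_stabilizer,
      Module.finrank_fintype_fun_eq_card]
    exact hcard
  let T : (σ → k) →ₗ[k] K := Fintype.linearCombination k fun i => (⟨_, hmem i⟩ : K)
  obtain ⟨a, ha, ha0⟩ := (Submodule.ne_bot_iff _).mp (T.ker_ne_bot_of_finrank_lt hfin)
  refine ⟨a, ha0, ?_⟩
  have hT := congrArg K.val (LinearMap.mem_ker.mp ha)
  rw [hg.eq_sum_C_coeff_mul_X]
  simpa [T, Fintype.linearCombination_apply, Algebra.smul_def, mul_comm] using hT

/-- Let `k` be a field, `L` a finite Galois extension of `k`, and let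
`f ∈ k[x₀, …, xₙ]` be a nonzero homogeneous polynomial of degree `d ≤ n` (`d ≥ 1`) which
factors over `L` as a product `f = h₁ ⋯ h_d` of homogeneous polynomials of degree 1.
Then `f` has a nontrivial zero over `k`: there is a nonzero `a ∈ k^{n+1}` with `f(a) = 0`. -/
theorem exists_nontrivial_zero_of_splits_into_linear_factors
    (k : Type*) [Field k] (L : Type*) [Field L] [Algebra k L]
    [FiniteDimensional k L] [IsGalois k L]
    (n d : ℕ) (hd : 1 ≤ d) (hdn : d ≤ n)
    (f : MvPolynomial (Fin (n + 1)) k) (hf0 : f ≠ 0) (hf : f.IsHomogeneous d)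
    (h : Fin d → MvPolynomial (Fin (n + 1)) L) (hh : ∀ i, (h i).IsHomogeneous 1)
    (hsplit : MvPolynomial.map (algebraMap k L) f = ∏ i, h i) :
    ∃ a : Fin (n + 1) → k, a ≠ 0 ∧ MvPolynomial.eval a f = 0 := by
  have hprod : ∏ i, h i ≠ 0 := by
    rw [← hsplit]
    exact (map_ne_zero_iff _ (MvPolynomial.map_injective _ (algebraMap k L).injective)).mpr hf0
  have h0 (i : Fin d) : h i ≠ 0 := Finset.prod_ne_zero_iff.mp hprod i (Finset.mem_univ i)
  let j : Fin d := ⟨0, hd⟩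
  obtain ⟨m, hm⟩ := MvPolynomial.ne_zero_iff.mp (h0 j)
  let g := MvPolynomial.C ((h j).coeff m)⁻¹ * h j
  have hg : g.IsHomogeneous 1 := (hh j).C_mul _
  have hgm : g.coeff m = 1 := by simp [g, hm]
  have hunit : IsUnit (MvPolynomial.C ((h j).coeff m)⁻¹ : MvPolynomial (Fin (n + 1)) L) :=
    (isUnit_iff_ne_zero.mpr (inv_ne_zero hm)).map _
  have hgdvd : g ∣ ∏ i, h i :=
    (hunit.mul_left_dvd.mpr dvd_rfl).trans (Finset.dvd_prod_of_mem h (Finset.mem_univ j))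
  have hcard := MvPolynomial.card_orbit_le_of_dvd_prod hh h0 hsplit hg hgm hgdvd
  obtain ⟨a, ha0, ha⟩ := hg.exists_zero_of_card_orbit_lt (k := k)
    (by rw [Fintype.card_fin]; lia)
  refine ⟨a, ha0, (algebraMap k L).injective ?_⟩
  have hja : MvPolynomial.eval (fun i => algebraMap k L (a i)) (h j) = 0 := by
    simpa [g, hm] using ha
  have heval : algebraMap k L (MvPolynomial.eval a f) =
      MvPolynomial.eval (fun i => algebraMap k L (a i)) (MvPolynomial.map (algebraMap k L) f) := by
    rw [MvPolynomial.eval_map]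
    exact MvPolynomial.eval₂_comp (algebraMap k L) a f
  rw [heval, hsplit, map_prod, map_zero]
  exact Finset.prod_eq_zero (Finset.mem_univ j) hja
end

section
/- Let k be a field, L a finite Galois extension of k with Galois group G acting coordinatewise on Lⁿ, and let V ⊆ Lⁿ be a G-invariant L-subspace of dimension r. Then V admits an L-basis t'₁,…,t'_r consisting of G-fixed vectors, i.e. g·t'ᵢ = t'ᵢ for every g ∈ G and every i = 1,…,r. -/
/-- A Galois-invariant subspace of `Lⁿ` is spanned by its Galois-fixed vectors. -/
theorem span_fixed_eq_of_invariant
    {k L ι : Type*} [Field k] [Field L] [Algebra k L] [FiniteDimensional k L] [IsGalois k L]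
    (V : Submodule L (ι → L))
    (hV : ∀ g : L ≃ₐ[k] L, ∀ v ∈ V, (fun i => g (v i)) ∈ V) :
    Submodule.span L {v | v ∈ V ∧ ∀ (g : L ≃ₐ[k] L) (j : ι), g (v j) = v j} = V := by
  refine le_antisymm (Submodule.span_le.2 fun v hv => hv.1) fun v hv => ?_
  let b := Module.finBasis k L
  have trace_mem (c : L) : (fun i => algebraMap k L (Algebra.trace k L (c * v i))) ∈ V := by
    have h : (fun i => algebraMap k L (Algebra.trace k L (c * v i))) =
        ∑ g : L ≃ₐ[k] L, fun i => g ((c • v) i) := by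
      ext i
      simp [trace_eq_sum_automorphisms]
    rw [h]
    exact V.sum_mem fun g _ => hV g _ (V.smul_mem c hv)
  have expand : v = ∑ j, b.traceDual j •
      fun i => algebraMap k L (Algebra.trace k L (b j * v i)) := by
    ext i
    conv_lhs => rw [← b.traceDual.sum_repr (v i)]
    simp [Algebra.traceForm_apply, Algebra.smul_def, mul_comm]
  rw [expand]
  exact Submodule.sum_mem _ fun j _ => Submodule.smul_mem _ _ <|
    Submodule.subset_span ⟨trace_mem (b j), fun g _ => g.commutes _⟩

/-- Let `L/k` be finite Galois with group `G = Gal(L/k)` acting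
coordinatewise on `Lⁿ`, and let `V ⊆ Lⁿ` be a `G`-invariant `L`-subspace of dimension `r`.
Then `V` admits an `L`-basis `t'₁, …, t'_r` consisting of `G`-fixed vectors. -/
theorem invariant_subspace_has_fixed_basis
    (k : Type*) [Field k] (L : Type*) [Field L] [Algebra k L]
    [FiniteDimensional k L] [IsGalois k L] (n r : ℕ)
    (V : Submodule L (Fin n → L))
    (hV : ∀ g : L ≃ₐ[k] L, ∀ v ∈ V, (fun i => g (v i)) ∈ V)
    (hr : Module.finrank L V = r) :
    ∃ t' : Fin r → (Fin n → L), (∀ i, t' i ∈ V) ∧ LinearIndependent L t' ∧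
      Submodule.span L (Set.range t') = V ∧
      ∀ (g : L ≃ₐ[k] L) (i : Fin r) (j : Fin n), g (t' i j) = t' i j := by
  have hspan := span_fixed_eq_of_invariant V hV
  obtain ⟨f, hf, hfs, hfi⟩ := Submodule.exists_fun_fin_finrank_span_eq L
    {v | v ∈ V ∧ ∀ (g : L ≃ₐ[k] L) (j : Fin n), g (v j) = v j}
  obtain rfl : Module.finrank L (Submodule.span L
      {v | v ∈ V ∧ ∀ (g : L ≃ₐ[k] L) (j : Fin n), g (v j) = v j}) = r := by
    rw [hspan, hr]
  exact ⟨f, fun i => (hf i).1, hfi, hfs.trans hspan, fun g i => (hf i).2 g⟩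
end
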